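/- arXiv:math/0209272 — 3 statements merged into one kernel-verified Lean document; each statement's English description precedes it below -/
import Mathlib

section
/- (Transformation obtained from Milne's A_n Watson transformation.) Let n be a positive integer and let M_1 and M_2 be nonnegative integers, both divisible by n. Then the sum over integer tuples (k_1,…,k_n) with k_1+⋯+k_n = 0 and M_1 + n·k_i + i - 1 ≥ 0 and M_2 - n·k_i + n - i ≥ 0 for all i, of q^{binom(n+1,2)·∑k_i² + ∑ i·k_i} · ∏_{1≤i<j≤n} (1 - q^{n·k_j - n·k_i + j - i}) · ∏_{i=1}^{n} (q;q)_{M_1+M_2+i-1} / ( (q;q)_{M_1+n·k_i+i-1} · (q;q)_{M_2-n·k_i+n-i} ), equals (-1)^{M_1} · q^{-binom(M_1+1,2)} · (q;q)_{M_1+M_2} / ( (q^{-n·M_1};q^n)_{M_1} · (q^n;q^n)_{M_2} ) times the sum over all tuples of nonnegative integers (k_1,…,k_{n-1}) with n·k_r ≤ M_1+M_2+n-r for all r (beyond which the terms vanish) of ∏_{1≤r<s≤n-1} (1 - q^{n·k_r - n·k_s + r - s})/(1 - q^{r-s}) · ∏_{r=1}^{n-1} [ (q^{-M_1-M_2-n+r};q)_{n·k_r}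 / (q^r;q)_{n·k_r} · q^{M_2·n·k_r} ] · q^{n·(1·k_1+2·k_2+⋯+(n-1)·k_{n-1})}. -/
open Finset

/-- The q-shifted factorial (q-Pochhammer symbol) `(a;q)_k = ∏_{j=0}^{k-1} (1 - a q^j)`. -/
noncomputable def qPoch {F : Type*} [Field F] (q a : F) (k : ℕ) : F :=
  ∏ j ∈ Finset.range k, (1 - a * q ^ j)

open Polynomial in
/-- Euler's polynomial `∏_{i<M} (1 + q^i X)`. -/
noncomputable def eulerPoly {F : Type*} [Field F] (q : F) (M : ℕ) : Polynomial F :=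
  ∏ i ∈ range M, (1 + C (q ^ i) * X)

/-- The coefficients of `eulerPoly`, indexed by the integers. -/
noncomputable def eulerCoeff {F : Type*} [Field F] (q : F) (M : ℕ) (b : ℤ) : F :=
  if 0 ≤ b then (eulerPoly q M).coeff b.toNat else 0

section Euler

variable {F : Type*} [Field F] (q : F)

open Polynomial in
lemma eulerPoly_succ_eq (M : ℕ) :
    eulerPoly q (M + 1) = (1 + X) * (eulerPoly q M).comp (C q * X) := by
  simp only [eulerPoly, prod_range_succ', Polynomial.prod_comp]
  rw [mul_comm]
  congr 1
  · simp
  · refine prod_congr rfl fun i _ => ?_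
    simp [pow_succ, mul_assoc]

open Polynomial in
lemma eulerPoly_succ_comp (M : ℕ) :
    (eulerPoly q (M + 1)).comp (C q * X) =
      (eulerPoly q M).comp (C q * X) * (1 + C (q ^ (M + 1)) * X) := by
  simp only [eulerPoly, prod_range_succ, Polynomial.mul_comp]
  simp [pow_succ, mul_assoc]

lemma eulerCoeff_natCast (M b : ℕ) : eulerCoeff q M b = (eulerPoly q M).coeff b := by
  simp [eulerCoeff]

lemma eulerCoeff_of_neg {M : ℕ} {b : ℤ} (hb : b < 0) : eulerCoeff q M b = 0 := by
  simp [eulerCoeff, not_le.mpr hb]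

lemma eulerPoly_coeff_zero (M : ℕ) : (eulerPoly q M).coeff 0 = 1 := by
  simp [eulerPoly, Polynomial.coeff_zero_prod]

lemma eulerPoly_natDegree_le (M : ℕ) : (eulerPoly q M).natDegree ≤ M := by
  refine (Polynomial.natDegree_prod_le _ _).trans ?_
  refine (Finset.sum_le_card_nsmul _ _ 1 fun i _ => ?_).trans (by simp)
  compute_degree

lemma eulerCoeff_of_gt {M : ℕ} {b : ℤ} (hb : (M : ℤ) < b) : eulerCoeff q M b = 0 := by
  rw [eulerCoeff, if_pos (by omega)]
  refine Polynomial.coeff_eq_zero_of_natDegree_lt ((eulerPoly_natDegree_le q M).trans_lt ?_)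
  omega

lemma eulerCoeff_support_finite (M : ℕ) : (Function.support (eulerCoeff q M)).Finite := by
  refine (Set.finite_Icc (0 : ℤ) M).subset fun b hb => ?_
  by_contra h
  rw [Set.mem_Icc, not_and_or, not_le, not_le] at h
  exact hb (h.elim (eulerCoeff_of_neg q) (eulerCoeff_of_gt q))

/-- The `q`-Pascal recurrence. -/
lemma eulerCoeff_succ (M : ℕ) (b : ℤ) :
    eulerCoeff q (M + 1) b =
      q ^ b * eulerCoeff q M b + q ^ (b - 1) * eulerCoeff q M (b - 1) := by
  rcases lt_or_ge b 0 with hb | hb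
  · simp [eulerCoeff_of_neg q hb, eulerCoeff_of_neg q (show b - 1 < 0 by omega)]
  obtain ⟨b, rfl⟩ := Int.eq_ofNat_of_zero_le hb
  rw [eulerCoeff_natCast, eulerCoeff_natCast, eulerPoly_succ_eq, add_mul, one_mul,
    Polynomial.coeff_add, Polynomial.comp_C_mul_X_coeff]
  rcases b with _ | b
  · simp [eulerCoeff]
  · rw [Polynomial.coeff_X_mul, Polynomial.comp_C_mul_X_coeff]
    have : (((b + 1 : ℕ) : ℤ) - 1) = (b : ℤ) := by push_cast; ring
    rw [this, eulerCoeff_natCast, zpow_natCast, zpow_natCast]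
    ring

lemma one_sub_zpow_mul_eulerCoeff_succ (M : ℕ) (b : ℤ) :
    (1 - q ^ b) * eulerCoeff q (M + 1) b =
      (1 - q ^ (M + 1)) * (q ^ (b - 1) * eulerCoeff q M (b - 1)) := by
  rcases lt_or_ge b 0 with hb | hb
  · simp [eulerCoeff_of_neg q hb, eulerCoeff_of_neg q (show b - 1 < 0 by omega)]
  obtain ⟨b, rfl⟩ := Int.eq_ofNat_of_zero_le hb
  rcases b with _ | b
  · simp [eulerCoeff]
  have key : eulerPoly q (M + 1) - (eulerPoly q (M + 1)).comp (Polynomial.C q * Polynomial.X) =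
      Polynomial.C (1 - q ^ (M + 1)) *
        (Polynomial.X * (eulerPoly q M).comp (Polynomial.C q * Polynomial.X)) := by
    rw [eulerPoly_succ_comp, eulerPoly_succ_eq, Polynomial.C_sub, Polynomial.C_1]
    ring
  have h := congrArg (fun p => Polynomial.coeff p (b + 1)) key
  simp only [Polynomial.coeff_sub, Polynomial.comp_C_mul_X_coeff, Polynomial.coeff_C_mul,
    Polynomial.coeff_X_mul] at h
  have : (((b + 1 : ℕ) : ℤ) - 1) = (b : ℤ) := by push_cast; ring
  rw [this, eulerCoeff_natCast, eulerCoeff_natCast, zpow_natCast, zpow_natCast]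
  linear_combination h

variable {q}

lemma qPoch_succ (a : F) (k : ℕ) : qPoch q a (k + 1) = qPoch q a k * (1 - a * q ^ k) := by
  simp [qPoch, prod_range_succ]

lemma qPoch_zero (a : F) : qPoch q a 0 = 1 := by simp [qPoch]

lemma qPoch_add (a : F) (k l : ℕ) :
    qPoch q a (k + l) = qPoch q a k * qPoch q (a * q ^ k) l := by
  simp [qPoch, prod_range_add, pow_add, mul_assoc]

lemma one_sub_pow_ne_zero (hq : ∀ m : ℕ, 0 < m → q ^ m ≠ 1) {k : ℕ} (hk : 0 < k) :
    1 - q ^ k ≠ 0 := sub_ne_zero.mpr (hq k hk).symm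

lemma qPoch_self_ne_zero (hq : ∀ m : ℕ, 0 < m → q ^ m ≠ 1) (k : ℕ) : qPoch q q k ≠ 0 := by
  rw [qPoch, prod_ne_zero_iff]
  intro j _
  rw [← pow_succ']
  exact one_sub_pow_ne_zero hq j.succ_pos

/-- The closed form of the coefficients of Euler's polynomial (the `q`-binomial theorem). -/
lemma eulerPoly_coeff_add (hq : ∀ m : ℕ, 0 < m → q ^ m ≠ 1) (b c : ℕ) :
    (eulerPoly q (b + c)).coeff b =
      q ^ b.choose 2 * qPoch q q (b + c) / (qPoch q q b * qPoch q q c) := by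
  induction b with
  | zero => simp [eulerPoly_coeff_zero, qPoch_zero, qPoch_self_ne_zero hq c]
  | succ b ih =>
    have h := one_sub_zpow_mul_eulerCoeff_succ q (b + c) ((b + 1 : ℕ) : ℤ)
    have h1 : (((b + 1 : ℕ) : ℤ) - 1) = (b : ℤ) := by push_cast; ring
    rw [h1, eulerCoeff_natCast, eulerCoeff_natCast, zpow_natCast, zpow_natCast, ih] at h
    have h2 := one_sub_pow_ne_zero hq b.succ_pos
    rw [show b + 1 + c = b + c + 1 by ring, Nat.choose_succ_succ' b 1, Nat.choose_one_right,
      qPoch_succ, qPoch_succ, ← pow_succ', ← pow_succ', pow_add]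
    have h3 := qPoch_self_ne_zero hq b
    have h4 := qPoch_self_ne_zero hq c
    have h5 : 1 - q ^ (b + 1) ≠ 0 := h2
    rw [eq_div_iff (mul_ne_zero (mul_ne_zero h3 h5) h4)]
    field_simp at h
    linear_combination h

end Euler

section LatticeSum

/-- The quadratic form in the exponent of the `A_{n-1}` theta function, `n = m + 1`. -/
def thetaExponent (m : ℕ) (k : Fin (m + 1) → ℤ) : ℤ :=
  ∑ i, (((m : ℤ) + 1) * (k i * (k i - 1) / 2) + (i : ℕ) * k i)

/-- The sum over integer points `k` with `∑ k_i = c` of the determinant with entries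
`C_j (n k_i + i)`, weighted by the coefficients of the `A_{n-1}` theta function, `n = m + 1`. -/
noncomputable def thetaDetSum {F : Type*} [Field F] (q : F) (m : ℕ) (c : ℤ)
    (C : Fin (m + 1) → ℤ → F) : F :=
  ∑ᶠ k : Fin (m + 1) → ℤ,
    if ∑ i, k i = c then
      q ^ thetaExponent m k *
        (Matrix.of fun i j : Fin (m + 1) => C j (((m : ℤ) + 1) * k i + (i : ℕ))).det
    else 0

lemma triangle_succ (k : ℤ) : (k + 1) * (k + 1 - 1) / 2 = k * (k - 1) / 2 + k := by
  rw [show (k + 1) * (k + 1 - 1) = k * (k - 1) + k * 2 by ring,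
    Int.add_mul_ediv_right _ _ two_ne_zero]

lemma two_mul_triangle (k : ℤ) : 2 * (k * (k - 1) / 2) = k * (k - 1) :=
  Int.mul_ediv_cancel' (Int.even_mul_pred_self k).two_dvd

variable {F : Type*} [Field F] {q : F} {m : ℕ}

/-- The bijection `k ↦ (k_1, …, k_m, k_0 - 1)` of the integer lattice. -/
def rotateLattice (m : ℕ) : (Fin (m + 1) → ℤ) ≃ (Fin (m + 1) → ℤ) :=
  (Equiv.arrowCongr (finRotate (m + 1)).symm (Equiv.refl ℤ)).trans
    (Equiv.subRight (Pi.single (Fin.last m) 1))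

lemma rotateLattice_castSucc (k : Fin (m + 1) → ℤ) (i : Fin m) :
    rotateLattice m k i.castSucc = k i.succ := by
  simp [rotateLattice, i.castSucc_lt_last.ne]

lemma rotateLattice_last (k : Fin (m + 1) → ℤ) :
    rotateLattice m k (Fin.last m) = k 0 - 1 := by
  simp [rotateLattice]

lemma sum_rotateLattice (k : Fin (m + 1) → ℤ) :
    ∑ i, rotateLattice m k i = ∑ i, k i - 1 := by
  simp only [Fin.sum_univ_castSucc (fun i => rotateLattice m k i), rotateLattice_castSucc,
    rotateLattice_last, Fin.sum_univ_succ k]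
  ring

lemma thetaExponent_rotateLattice (k : Fin (m + 1) → ℤ) :
    thetaExponent m k = thetaExponent m (rotateLattice m k) + (∑ i, k i - 1) := by
  have h := triangle_succ (k 0 - 1)
  rw [sub_add_cancel] at h
  simp only [thetaExponent]
  rw [Fin.sum_univ_succ, Fin.sum_univ_castSucc (n := m), Fin.sum_univ_succ k]
  simp only [rotateLattice_castSucc, rotateLattice_last, h, Fin.val_succ, Fin.val_castSucc,
    Fin.val_last, Fin.val_zero, sum_add_distrib, add_mul, one_mul, Nat.cast_add, Nat.cast_one]
  push_cast
  ring

lemma rotateLattice_residue (k : Fin (m + 1) → ℤ) (i : Fin (m + 1)) :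
    ((m : ℤ) + 1) * k (finRotate (m + 1) i) + ((finRotate (m + 1) i : Fin (m + 1)) : ℕ) =
      ((m : ℤ) + 1) * rotateLattice m k i + (i : ℕ) + 1 := by
  refine Fin.lastCases ?_ (fun i => ?_) i
  · simp only [rotateLattice_last, finRotate_last, Fin.val_last, Fin.val_zero]
    push_cast
    ring
  · simp only [rotateLattice_castSucc, Fin.val_castSucc]
    rw [show finRotate (m + 1) i.castSucc = i.succ by simp]
    push_cast [Fin.val_succ]
    ring

/-- Rotating the rows of the determinants. -/
lemma thetaDetSum_rotate (hq0 : q ≠ 0) (c : ℤ) (C : Fin (m + 1) → ℤ → F) :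
    thetaDetSum q m c C =
      (-1) ^ m * q ^ (c - 1) * thetaDetSum q m (c - 1) (fun j a => C j (a + 1)) := by
  rw [thetaDetSum, thetaDetSum, mul_finsum]
  symm
  rw [← finsum_comp_equiv (rotateLattice m)]
  refine finsum_congr fun k => ?_
  symm
  rw [sum_rotateLattice]
  by_cases h : ∑ i, k i = c
  · rw [if_pos h, if_pos (by rw [h]), thetaExponent_rotateLattice, h, zpow_add₀ hq0]
    have hdet := Matrix.det_permute (finRotate (m + 1))
      (Matrix.of fun i j : Fin (m + 1) => C j (((m : ℤ) + 1) * k i + (i : ℕ)))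
    have hsub : (Matrix.of fun i j : Fin (m + 1) =>
          C j (((m : ℤ) + 1) * k i + (i : ℕ))).submatrix (finRotate (m + 1)) id =
        Matrix.of fun i j : Fin (m + 1) =>
          C j (((m : ℤ) + 1) * rotateLattice m k i + (i : ℕ) + 1) := by
      ext i j
      simp only [Matrix.submatrix_apply, Matrix.of_apply, id, rotateLattice_residue]
    rw [hsub, sign_finRotate] at hdet
    rw [hdet]
    have : ((-1 : F) ^ m) * (-1) ^ m = 1 := by rw [← mul_pow]; simp
    simp only [Nat.add_sub_cancel, Units.val_pow_eq_pow_val, Units.val_neg, Units.val_one,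
      Int.cast_pow, Int.cast_neg, Int.cast_one]
    linear_combination (-(q ^ thetaExponent m (rotateLattice m k) * q ^ (c - 1) *
      (Matrix.of fun i j : Fin (m + 1) => C j (((m : ℤ) + 1) * k i + (i : ℕ))).det)) * this
  · rw [if_neg h, if_neg (by omega), mul_zero]

lemma finite_lattice_support {C : Fin (m + 1) → ℤ → F}
    (hC : ∀ j, (Function.support (C j)).Finite) {g : (Fin (m + 1) → ℤ) → F}
    (hg : ∀ k, g k ≠ 0 → ∀ i : Fin (m + 1), ∃ j, C j (((m : ℤ) + 1) * k i + (i : ℕ)) ≠ 0) :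
    (Function.support g).Finite := by
  have hS : (⋃ j, Function.support (C j)).Finite := Set.finite_iUnion hC
  refine (Set.Finite.pi (t := fun i : Fin (m + 1) =>
    (fun x : ℤ => ((m : ℤ) + 1) * x + (i : ℕ)) ⁻¹' (⋃ j, Function.support (C j)))
    fun i => hS.preimage ?_).subset fun k hk => ?_
  · intro x _ y _ hxy
    have : ((m : ℤ) + 1) ≠ 0 := by omega
    simpa [this] using hxy
  · intro i _
    obtain ⟨j, hj⟩ := hg k hk i
    exact Set.mem_iUnion.mpr ⟨j, hj⟩

lemma thetaDetSum_support_finite (c : ℤ) {C : Fin (m + 1) → ℤ → F}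
    (hC : ∀ j, (Function.support (C j)).Finite) :
    (Function.support fun k : Fin (m + 1) → ℤ =>
      if ∑ i, k i = c then
        q ^ thetaExponent m k *
          (Matrix.of fun i j : Fin (m + 1) => C j (((m : ℤ) + 1) * k i + (i : ℕ))).det
      else 0).Finite := by
  refine finite_lattice_support hC fun k hk i => ?_
  by_contra! h
  refine hk ?_
  rw [Matrix.det_eq_zero_of_row_eq_zero i (by simpa using h)]
  simp

lemma thetaExponent_add_single (k : Fin (m + 1) → ℤ) (i : Fin (m + 1)) :
    thetaExponent m (k + Pi.single i 1) =
      thetaExponent m k + (((m : ℤ) + 1) * k i + (i : ℕ)) := by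
  simp only [thetaExponent]
  rw [← sub_eq_iff_eq_add', ← sum_sub_distrib, sum_eq_single i]
  · simp only [Pi.add_apply, Pi.single_eq_same, triangle_succ]
    ring
  · intro j _ hj
    simp [hj]
  · simp

lemma thetaDetSum_eq_sum_perm (c : ℤ) {C : Fin (m + 1) → ℤ → F}
    (hC : ∀ j, (Function.support (C j)).Finite) :
    thetaDetSum q m c C =
      ∑ σ : Equiv.Perm (Fin (m + 1)), ((Equiv.Perm.sign σ : ℤ) : F) *
        ∑ᶠ k : Fin (m + 1) → ℤ, if ∑ i, k i = c then
          q ^ thetaExponent m k *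
            ∏ j, C j (((m : ℤ) + 1) * k (σ j) + ((σ j : Fin (m + 1)) : ℕ)) else 0 := by
  simp_rw [mul_finsum]
  rw [thetaDetSum, ← finsum_sum_comm]
  · refine finsum_congr fun k => ?_
    split_ifs
    · simp only [Matrix.det_apply', Matrix.of_apply, mul_sum]
      exact sum_congr rfl fun σ _ => by ring
    · simp
  · intro σ _
    refine finite_lattice_support hC fun k hk i => ⟨σ.symm i, fun h => hk ?_⟩
    rw [prod_eq_zero (mem_univ (σ.symm i)) (by simpa using h)]
    simp

/-- Shifting one coordinate: the quasi-periodicity of the theta function. -/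
lemma thetaDetSum_shift (hq0 : q ≠ 0) (c : ℤ) {C D : Fin (m + 1) → ℤ → F}
    (hC : ∀ j, (Function.support (C j)).Finite) (hD : ∀ j, (Function.support (D j)).Finite)
    (h0 : ∀ a, C 0 a = q ^ a * D 0 (a + (m + 1))) (hs : ∀ j : Fin m, C j.succ = D j.succ) :
    thetaDetSum q m c C = thetaDetSum q m (c + 1) D := by
  rw [thetaDetSum_eq_sum_perm c hC, thetaDetSum_eq_sum_perm (c + 1) hD]
  refine sum_congr rfl fun σ _ => ?_
  congr 1
  symm
  rw [← finsum_comp_equiv (Equiv.addRight (Pi.single (σ 0) (1 : ℤ)))]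
  refine finsum_congr fun k => ?_
  symm
  simp only [Equiv.coe_addRight, Pi.add_apply, sum_add_distrib, thetaExponent_add_single]
  rw [Fintype.sum_pi_single' (σ 0) (1 : ℤ)]
  by_cases h : ∑ i, k i = c
  · rw [if_pos h, if_pos (by rw [h]), Fin.prod_univ_succ, Fin.prod_univ_succ,
      add_comm (thetaExponent m k), zpow_add₀ hq0 _ (thetaExponent m k), h0, Pi.single_eq_same]
    have : ∀ j : Fin m, (Pi.single (σ 0) (1 : ℤ) : Fin (m + 1) → ℤ) (σ j.succ) = 0 := fun j =>
      Pi.single_eq_of_ne (by simp [Fin.succ_ne_zero]) _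
    simp only [this, add_zero, hs]
    rw [show ((m : ℤ) + 1) * (k (σ 0) + 1) + ((σ 0 : Fin (m + 1)) : ℕ) =
      ((m : ℤ) + 1) * k (σ 0) + ((σ 0 : Fin (m + 1)) : ℕ) + (m + 1) by ring]
    ring
  · rw [if_neg h, if_neg (by omega)]

end LatticeSum

section Recurrence

variable {F : Type*} [Field F] {q : F} {m : ℕ}

lemma thetaDetSum_eq_mul {c : ℤ} {C D : Fin (m + 1) → ℤ → F} (r : F)
    (h : ∀ a : Fin (m + 1) → ℤ, ∑ i, a i = ((m : ℤ) + 1) * c + ∑ i : Fin (m + 1), ((i : ℕ) : ℤ) →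
      (Matrix.of fun i j : Fin (m + 1) => C j (a i)).det =
        r * (Matrix.of fun i j : Fin (m + 1) => D j (a i)).det) :
    thetaDetSum q m c C = r * thetaDetSum q m c D := by
  rw [thetaDetSum, thetaDetSum, mul_finsum]
  refine finsum_congr fun k => ?_
  split_ifs with hk
  · rw [h _ (by rw [sum_add_distrib, ← mul_sum, hk])]
    ring
  · simp

lemma thetaDetSum_sub {c : ℤ} {A B : Fin (m + 1) → ℤ → F}
    (hA : ∀ j, (Function.support (A j)).Finite) (hB : ∀ j, (Function.support (B j)).Finite)
    (hs : ∀ j : Fin m, A j.succ = B j.succ) :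
    thetaDetSum q m c A - thetaDetSum q m c B =
      thetaDetSum q m c (Fin.cons (fun a => A 0 a - B 0 a) fun j => A j.succ) := by
  simp only [thetaDetSum]
  rw [← finsum_sub_distrib (thetaDetSum_support_finite c hA) (thetaDetSum_support_finite c hB)]
  refine finsum_congr fun k => ?_
  split_ifs
  · rw [← mul_sub]
    congr 1
    simp only [Matrix.det_succ_column_zero]
    rw [← sum_sub_distrib]
    refine sum_congr rfl fun i _ => ?_
    have h1 : (Matrix.of fun i j : Fin (m + 1) =>
          B j (((m : ℤ) + 1) * k i + (i : ℕ))).submatrix i.succAbove Fin.succ =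
        (Matrix.of fun i j : Fin (m + 1) =>
          A j (((m : ℤ) + 1) * k i + (i : ℕ))).submatrix i.succAbove Fin.succ := by
      ext; simp [hs]
    have h2 : (Matrix.of fun i j : Fin (m + 1) =>
          (Fin.cons (fun a => A 0 a - B 0 a) (fun j : Fin m => A j.succ) :
            Fin (m + 1) → ℤ → F) j (((m : ℤ) + 1) * k i + (i : ℕ))).submatrix
            i.succAbove Fin.succ =
        (Matrix.of fun i j : Fin (m + 1) =>
          A j (((m : ℤ) + 1) * k i + (i : ℕ))).submatrix i.succAbove Fin.succ := by
      ext; simp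
    rw [h1, h2]
    simp only [Matrix.of_apply, Fin.cons_zero]
    ring
  · simp

/-- The theta-weighted sum of the determinants `det (e_{a_i - j})`, where the `e_b` are the
coefficients of Euler's polynomial. -/
noncomputable def thetaEulerSum (q : F) (m M : ℕ) (c : ℤ) : F :=
  thetaDetSum q m c fun j a => eulerCoeff q M (a - (j : ℕ))

lemma support_comp_sub_finite {f : ℤ → F} (hf : (Function.support f).Finite) (d : ℤ) :
    (Function.support fun a => f (a - d)).Finite :=
  hf.preimage (f := fun a => a - d) (sub_left_injective.injOn)

lemma support_mul_finite {f : ℤ → F} (hf : (Function.support f).Finite) (g : ℤ → F) :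
    (Function.support fun a => g a * f a).Finite :=
  hf.subset fun a ha h => ha (by simp [h])

/-- Multiplying the first column by `q^a` multiplies the sum by `q^c`. -/
lemma thetaDetSum_scale_first (hq0 : q ≠ 0) (M : ℕ) (c : ℤ) :
    thetaDetSum q m c (Fin.cons (fun a => q ^ a * eulerCoeff q M a)
        fun j : Fin m => fun a => eulerCoeff q M (a - ((j : ℕ) + 1))) =
      q ^ c * thetaEulerSum q m M c := by
  have hf := eulerCoeff_support_finite q M
  rw [thetaDetSum_shift hq0 c
    (D := Fin.cons (fun a => eulerCoeff q M (a - (m + 1)))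
      fun j : Fin m => fun a => eulerCoeff q M (a - ((j : ℕ) + 1)))
    (fun j => by
      refine Fin.cases ?_ (fun j => ?_) j
      · exact support_mul_finite hf _
      · exact support_comp_sub_finite hf _)
    (fun j => by
      refine Fin.cases ?_ (fun j => ?_) j
      · exact support_comp_sub_finite hf _
      · exact support_comp_sub_finite hf _)
    (by simp) (by simp), thetaDetSum_rotate hq0, add_sub_cancel_right, thetaEulerSum,
    thetaDetSum_eq_mul (D := fun j a => eulerCoeff q M (a - (j : ℕ))) ((-1) ^ m)]
  · have : ((-1 : F) ^ m) * (-1) ^ m = 1 := by rw [← mul_pow]; simp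
    linear_combination (q ^ c * thetaDetSum q m c fun j a => eulerCoeff q M (a - (j : ℕ))) * this
  · intro a _
    have h := Matrix.det_permute' (finRotate (m + 1)) (Matrix.of fun i j : Fin (m + 1) =>
      (Fin.cons (fun a => eulerCoeff q M (a - (m + 1)))
        (fun (j : Fin m) a => eulerCoeff q M (a - ((j : ℕ) + 1))) : Fin (m + 1) → ℤ → F) j
        (a i + 1))
    have h1 : (Matrix.of fun i j : Fin (m + 1) =>
      (Fin.cons (fun a => eulerCoeff q M (a - (m + 1)))
        (fun (j : Fin m) a => eulerCoeff q M (a - ((j : ℕ) + 1))) : Fin (m + 1) → ℤ → F) j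
        (a i + 1)).submatrix id (finRotate (m + 1)) =
        Matrix.of fun i j : Fin (m + 1) => eulerCoeff q M (a i - (j : ℕ)) := by
      ext i j
      refine Fin.lastCases ?_ (fun j => ?_) j
      · simp
      · have h2 : finRotate (m + 1) j.castSucc = j.succ := by simp
        simp [h2]
    rw [h1, sign_finRotate] at h
    rw [h]
    have : ((-1 : F) ^ m) * (-1) ^ m = 1 := by rw [← mul_pow]; simp
    simp only [Nat.add_sub_cancel, Units.val_pow_eq_pow_val, Units.val_neg, Units.val_one,
      Int.cast_pow, Int.cast_neg, Int.cast_one]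
    rw [← mul_assoc, this, one_mul]

lemma thetaEulerSum_succ (hq0 : q ≠ 0) (M : ℕ) (c : ℤ) :
    (1 - q ^ c) * thetaEulerSum q m (M + 1) c =
      (1 - q ^ (M + 1)) * ((-1) ^ m * q ^ (((m : ℤ) + 2) * (c - 1))) *
        thetaEulerSum q m M (c - 1) := by
  have hf := eulerCoeff_support_finite q (M + 1)
  have hE : thetaEulerSum q m (M + 1) c = thetaDetSum q m c
      (Fin.cons (fun a => eulerCoeff q (M + 1) a)
        fun j : Fin m => fun a => eulerCoeff q (M + 1) (a - ((j : ℕ) + 1))) := by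
    rw [thetaEulerSum]
    congr 1
    ext j a
    refine Fin.cases ?_ (fun j => ?_) j <;> simp
  have h1 : (1 - q ^ c) * thetaEulerSum q m (M + 1) c = thetaDetSum q m c
      (Fin.cons (fun a => (1 - q ^ a) * eulerCoeff q (M + 1) a)
        fun j : Fin m => fun a => eulerCoeff q (M + 1) (a - ((j : ℕ) + 1))) := by
    rw [sub_mul, one_mul, ← thetaDetSum_scale_first hq0, hE, thetaDetSum_sub]
    · simp only [Fin.cons_zero, Fin.cons_succ, sub_mul, one_mul]
    · intro j
      refine Fin.cases ?_ (fun j => ?_) j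
      · exact hf
      · exact support_comp_sub_finite hf _
    · intro j
      refine Fin.cases ?_ (fun j => ?_) j
      · exact support_mul_finite hf _
      · exact support_comp_sub_finite hf _
    · simp
  have h2 : thetaDetSum q m c
      (Fin.cons (fun a => (1 - q ^ a) * eulerCoeff q (M + 1) a)
        fun j : Fin m => fun a => eulerCoeff q (M + 1) (a - ((j : ℕ) + 1))) =
      (1 - q ^ (M + 1)) * thetaDetSum q m c
        (fun j a => q ^ (a - 1 - (j : ℕ)) * eulerCoeff q M (a - 1 - (j : ℕ))) := by
    refine thetaDetSum_eq_mul _ fun a _ => ?_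
    rw [Matrix.det_eq_of_forall_col_eq_smul_add_pred (fun _ => (-1 : F))
      (A := Matrix.of fun i j : Fin (m + 1) =>
        q ^ (a i - 1 - (j : ℕ)) * eulerCoeff q M (a i - 1 - (j : ℕ)))
      (B := Matrix.of fun i => Fin.cons (q ^ (a i - 1) * eulerCoeff q M (a i - 1))
        fun j : Fin m => eulerCoeff q (M + 1) (a i - ((j : ℕ) + 1)))
      (by simp) ?_, Matrix.det_succ_column_zero, Matrix.det_succ_column_zero, mul_sum]
    · refine sum_congr rfl fun i _ => ?_
      simp only [Matrix.of_apply, Fin.cons_zero, one_sub_zpow_mul_eulerCoeff_succ]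
      rw [mul_left_comm, ← mul_assoc, ← mul_assoc, ← mul_assoc]
      congr 1
      · ring
    · intro i j
      simp only [Matrix.of_apply, Fin.cons_succ, Fin.val_succ, Fin.val_castSucc,
        eulerCoeff_succ q M]
      push_cast
      rw [show a i - 1 - ((j : ℕ) + 1 : ℤ) = a i - ((j : ℕ) + 1 : ℤ) - 1 by ring,
        show a i - 1 - ((j : ℕ) : ℤ) = a i - ((j : ℕ) + 1 : ℤ) by ring]
      ring
  have h3 : thetaDetSum q m (c - 1)
      (fun j a => q ^ (a + 1 - 1 - (j : ℕ)) * eulerCoeff q M (a + 1 - 1 - (j : ℕ))) =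
      q ^ (((m : ℤ) + 1) * (c - 1)) * thetaEulerSum q m M (c - 1) := by
    refine thetaDetSum_eq_mul _ fun a ha => ?_
    have : (Matrix.of fun i j : Fin (m + 1) =>
        q ^ (a i + 1 - 1 - (j : ℕ)) * eulerCoeff q M (a i + 1 - 1 - (j : ℕ))) =
        Matrix.of fun i j : Fin (m + 1) => q ^ a i * (Matrix.of fun i j : Fin (m + 1) =>
          q ^ (-((j : ℕ) : ℤ)) * eulerCoeff q M (a i - (j : ℕ))) i j := by
      ext i j
      simp only [Matrix.of_apply, add_sub_cancel_right]
      rw [sub_eq_add_neg, zpow_add₀ hq0, mul_assoc]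
    have hrow : (Matrix.of fun i j : Fin (m + 1) =>
        q ^ (-((j : ℕ) : ℤ)) * eulerCoeff q M (a i - (j : ℕ))).det =
        (∏ j : Fin (m + 1), q ^ (-((j : ℕ) : ℤ))) *
          (Matrix.of fun i j : Fin (m + 1) => eulerCoeff q M (a i - (j : ℕ))).det :=
      Matrix.det_mul_row _ _
    rw [this, Matrix.det_mul_column, hrow, ← mul_assoc]
    congr 1
    have hz : ∀ f : Fin (m + 1) → ℤ, ∏ i, q ^ f i = q ^ ∑ i, f i := fun f => by
      induction (univ : Finset (Fin (m + 1))) using Finset.induction_on with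
      | empty => simp
      | insert i s hi ih => rw [prod_insert hi, sum_insert hi, zpow_add₀ hq0, ih]
    rw [hz, hz, ← zpow_add₀ hq0, ha, sum_neg_distrib]
    congr 1
    ring
  rw [h1, h2, thetaDetSum_rotate hq0, h3, show ((m : ℤ) + 2) * (c - 1) =
    (c - 1) + ((m : ℤ) + 1) * (c - 1) by ring, zpow_add₀ hq0]
  ring

lemma thetaEulerSum_zero (M : ℕ) : thetaEulerSum q m M 0 = 1 := by
  rw [thetaEulerSum, thetaDetSum, finsum_eq_single _ 0]
  · have : (Matrix.of fun i j : Fin (m + 1) =>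
        eulerCoeff q M (((i : ℕ) : ℤ) - (j : ℕ))).det = 1 := by
      rw [Matrix.det_of_isLowerTriangular]
      · simp [eulerCoeff, eulerPoly_coeff_zero]
      · intro i j hij
        exact eulerCoeff_of_neg q (by simpa using hij)
    simp [thetaExponent, this]
  · intro k hk
    split_ifs with h
    · obtain ⟨i, hi⟩ : ∃ i, k i < 0 := by
        by_contra! h0
        exact hk (funext fun i => (sum_eq_zero_iff_of_nonneg fun i _ => h0 i).mp h i (mem_univ i))
      rw [Matrix.det_eq_zero_of_row_eq_zero i, mul_zero]
      intro j
      refine eulerCoeff_of_neg q ?_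
      have := i.is_lt
      nlinarith
    · rfl

lemma thetaEulerSum_add (hq0 : q ≠ 0) (hq : ∀ m : ℕ, 0 < m → q ^ m ≠ 1) (M c : ℕ) :
    thetaEulerSum q m (M + c) c =
      (-1) ^ (m * c) * q ^ ((m + 2) * c.choose 2) *
        (qPoch q q (M + c) / (qPoch q q c * qPoch q q M)) := by
  induction c with
  | zero => simp [thetaEulerSum_zero, qPoch_zero, qPoch_self_ne_zero hq M]
  | succ c ih =>
    have h := thetaEulerSum_succ (m := m) hq0 (M + c) ((c + 1 : ℕ) : ℤ)
    have h1 : (((c + 1 : ℕ) : ℤ) - 1) = (c : ℤ) := by push_cast; ring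
    rw [h1, ih, zpow_natCast, show ((m : ℤ) + 2) * c = ((m + 2) * c : ℕ) by push_cast; ring,
      zpow_natCast] at h
    refine mul_left_cancel₀ (one_sub_pow_ne_zero hq c.succ_pos) ?_
    rw [Nat.succ_eq_add_one, ← add_assoc, h, Nat.choose_succ_succ' c 1, Nat.choose_one_right,
      qPoch_succ, qPoch_succ, ← pow_succ', ← pow_succ', mul_add (m + 2), pow_add, mul_add m, pow_add,
      mul_one]
    have h3 := qPoch_self_ne_zero hq c
    have h4 := qPoch_self_ne_zero hq M
    have h5 : 1 - q ^ (c + 1) ≠ 0 := one_sub_pow_ne_zero hq c.succ_pos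
    field_simp
    rw [show 1 + 1 = 2 from rfl, pow_add, pow_add]
    ring

end Recurrence

section EulerDeterminant

variable {F : Type*} [Field F] {q : F}

lemma choose_two_add (b j : ℕ) :
    (b + j).choose 2 + j + j.choose 2 = b.choose 2 + j * (b + j) := by
  induction j with
  | zero => simp
  | succ j ih =>
    rw [← add_assoc b j 1, Nat.choose_succ_succ' (b + j) 1, Nat.choose_succ_succ' j 1,
      Nat.choose_one_right, Nat.choose_one_right]
    linarith

lemma two_mul_choose_two (a : ℕ) : 2 * ((a.choose 2 : ℕ) : ℤ) = a * ((a : ℤ) - 1) := by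
  induction a with
  | zero => simp
  | succ a ih =>
    rw [Nat.choose_succ_succ' a 1, Nat.choose_one_right]
    push_cast
    linarith

lemma prod_pow_sub_pow_add (b j : ℕ) :
    ∏ t ∈ range j, (q ^ t - q ^ (b + j)) = q ^ j.choose 2 * qPoch q (q * q ^ b) j := by
  induction j with
  | zero => simp [qPoch_zero]
  | succ j ih =>
    have h : ∏ t ∈ range j, (q ^ (t + 1) - q ^ (b + (j + 1))) =
        q ^ j * ∏ t ∈ range j, (q ^ t - q ^ (b + j)) := by
      rw [← card_range j, ← prod_const, card_range, ← prod_mul_distrib]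
      exact prod_congr rfl fun t _ => by ring
    rw [prod_range_succ', h, ih, qPoch_succ, Nat.choose_succ_succ' j 1, Nat.choose_one_right,
      pow_add]
    ring

lemma prod_pow_sub_pow_shift (d c l : ℕ) :
    ∏ t ∈ range l, (q ^ d - q ^ (d + c + t + 1)) = q ^ (d * l) * qPoch q (q * q ^ c) l := by
  rw [qPoch, pow_mul, ← card_range l, ← prod_const, card_range, ← prod_mul_distrib]
  exact prod_congr rfl fun t _ => by ring

open Polynomial in
/-- Up to a factor independent of `j`, the entry `e_{a-j}` is the value at `q^a` of this
polynomial. -/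
noncomputable def eulerEntryPoly (q : F) (M m j : ℕ) : Polynomial F :=
  C (q ^ j) * (∏ t ∈ range j, (C (q ^ t) - X)) *
    ∏ t ∈ range (m - j), (X - C (q ^ (M + j + t + 1)))

open Polynomial in
lemma eulerEntryPoly_natDegree_lt (M m : ℕ) {j : ℕ} (hj : j ≤ m) :
    (eulerEntryPoly q M m j).natDegree < m + 1 := by
  have h1 : (∏ t ∈ range j, (C (q ^ t) - X)).natDegree ≤ j := by
    refine (natDegree_prod_le _ _).trans ?_
    refine (Finset.sum_le_card_nsmul _ _ 1 fun i _ => ?_).trans (by simp)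
    compute_degree
  have h2 : (∏ t ∈ range (m - j), (X - C (q ^ (M + j + t + 1)))).natDegree ≤ m - j := by
    refine (natDegree_prod_le _ _).trans ?_
    refine (Finset.sum_le_card_nsmul _ _ 1 fun i _ => ?_).trans (by simp)
    compute_degree
  have h3 : (C (q ^ j) * ∏ t ∈ range j, (C (q ^ t) - X)).natDegree ≤ j :=
    (natDegree_C_mul_le _ _).trans h1
  have := natDegree_mul_le_of_le h3 h2
  rw [eulerEntryPoly]
  omega

lemma eulerCoeff_sub_mul (hq : ∀ m : ℕ, 0 < m → q ^ m ≠ 1) {M m a j : ℕ} (ha : a ≤ M + m)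
    (hj : j ≤ m) :
    q ^ (m * a) * (qPoch q q a * qPoch q q (M + m - a)) * eulerCoeff q M ((a : ℤ) - j) =
      q ^ a.choose 2 * qPoch q q M * (eulerEntryPoly q M m j).eval (q ^ a) := by
  simp only [eulerEntryPoly, Polynomial.eval_mul, Polynomial.eval_prod, Polynomial.eval_sub,
    Polynomial.eval_C, Polynomial.eval_X]
  rcases lt_or_ge a j with h | h
  · rw [eulerCoeff_of_neg q (by omega), prod_eq_zero (mem_range.mpr h) (sub_self _)]
    ring
  obtain ⟨b, rfl⟩ := Nat.exists_eq_add_of_le' h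
  rcases lt_or_ge M b with h' | h'
  · rw [eulerCoeff_of_gt q (by push_cast; omega),
      prod_eq_zero (i := b - M - 1) (s := range (m - j)) (mem_range.mpr (by omega))]
    · ring
    · rw [show M + j + (b - M - 1) + 1 = b + j by omega, sub_self]
  obtain ⟨c, rfl⟩ := Nat.exists_eq_add_of_le h'
  obtain ⟨l, rfl⟩ := Nat.exists_eq_add_of_le hj
  have h1 := qPoch_self_ne_zero hq b
  have h2 := qPoch_self_ne_zero hq c
  have h3 : ∏ t ∈ range l, (q ^ (b + j) - q ^ (b + c + j + t + 1)) =
      q ^ ((b + j) * l) * qPoch q (q * q ^ c) l := by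
    rw [← prod_pow_sub_pow_shift]
    exact prod_congr rfl fun t _ => by ring
  rw [show ((b + j : ℕ) : ℤ) - j = (b : ℕ) by push_cast; ring, eulerCoeff_natCast,
    eulerPoly_coeff_add hq, Nat.add_sub_cancel_left, h3, prod_pow_sub_pow_add,
    show b + c + (j + l) - (b + j) = c + l by omega, qPoch_add q b j, qPoch_add q c l,
    show q ^ ((j + l) * (b + j)) = q ^ (j * (b + j)) * q ^ ((b + j) * l) by ring]
  have h4 := congrArg (q ^ ·) (choose_two_add b j)
  simp only [pow_add _ _ (Nat.choose _ _), pow_add _ _ j, pow_add _ _ (j * (b + j))] at h4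
  field_simp
  linear_combination (-qPoch q q (b + c) * qPoch q (q * q ^ b) j * qPoch q (q * q ^ c) l *
    q ^ ((b + j) * l)) * h4

open Matrix in
lemma det_eulerCoeff_mul (hq : ∀ m : ℕ, 0 < m → q ^ m ≠ 1) (M m : ℕ) (a : Fin (m + 1) → ℕ)
    (ha : ∀ i, a i ≤ M + m) :
    (∏ i, q ^ (m * a i) * (qPoch q q (a i) * qPoch q q (M + m - a i))) *
        (Matrix.of fun i j : Fin (m + 1) => eulerCoeff q M ((a i : ℤ) - (j : ℕ))).det =
      (∏ i, q ^ (a i).choose 2 * qPoch q q M) * ((vandermonde fun i => q ^ a i).det *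
        (Matrix.of fun i j : Fin (m + 1) => (eulerEntryPoly q M m j).coeff i).det) := by
  rw [← det_mul_column, ← det_mul, ← det_mul_column]
  congr 1
  ext i j
  simp only [of_apply, mul_apply, vandermonde_apply]
  rw [eulerCoeff_sub_mul hq (ha i) (Nat.lt_succ_iff.mp j.is_lt),
    Polynomial.eval_eq_sum_range' (eulerEntryPoly_natDegree_lt M m (Nat.lt_succ_iff.mp j.is_lt)),
    ← Fin.sum_univ_eq_sum_range (fun t => (eulerEntryPoly q M m j).coeff t * (q ^ a i) ^ t)]
  simp only [mul_comm]

lemma zpow_sum_eq_prod (hq0 : q ≠ 0) {ι : Type*} (s : Finset ι) (f : ι → ℤ) :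
    q ^ ∑ i ∈ s, f i = ∏ i ∈ s, q ^ f i := by
  classical
  induction s using Finset.induction_on with
  | empty => simp
  | insert i s hi ih => rw [prod_insert hi, sum_insert hi, zpow_add₀ hq0, ih]

lemma det_eulerCoeff_id (M m : ℕ) :
    (Matrix.of fun i j : Fin (m + 1) => eulerCoeff q M (((i : ℕ) : ℤ) - (j : ℕ))).det = 1 := by
  rw [Matrix.det_of_isLowerTriangular]
  · simp [eulerCoeff, eulerPoly_coeff_zero]
  · intro i j hij
    exact eulerCoeff_of_neg q (by simpa using hij)

lemma vandermonde_pow_det (hq0 : q ≠ 0) (m : ℕ) (a : Fin (m + 1) → ℕ) :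
    (Matrix.vandermonde fun i => q ^ a i).det =
      (∏ i : Fin (m + 1), (-1) ^ (m - (i : ℕ))) * (∏ i : Fin (m + 1), q ^ (a i * (m - i))) *
        ∏ i, ∏ j ∈ Ioi i, (1 - q ^ ((a j : ℤ) - a i)) := by
  rw [Matrix.det_vandermonde, ← prod_mul_distrib, ← prod_mul_distrib]
  refine prod_congr rfl fun i _ => ?_
  have : (-1) ^ (m - (i : ℕ)) * q ^ (a i * (m - i)) = ∏ j ∈ Ioi i, -q ^ a i := by
    rw [prod_const, Fin.card_Ioi, pow_mul, ← mul_pow, neg_one_mul]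
    congr 1
  rw [this, ← prod_mul_distrib]
  refine prod_congr rfl fun j _ => ?_
  rw [neg_mul, mul_sub, mul_one, ← zpow_natCast, ← zpow_natCast, ← zpow_add₀ hq0, add_sub_cancel,
    neg_sub]

lemma prod_Ioi_one_sub_pow (m : ℕ) :
    ∏ i : Fin (m + 1), ∏ j ∈ Ioi i, (1 - q ^ (((j : ℕ) : ℤ) - (i : ℕ))) =
      ∏ i : Fin (m + 1), qPoch q q i := by
  induction m with
  | zero => simp [qPoch_zero]
  | succ m ih =>
    rw [Fin.prod_univ_succ, Fin.prod_Ioi_zero, Fin.prod_univ_castSucc (n := m + 1), mul_comm]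
    simp only [Fin.val_castSucc]
    congr 1
    · rw [← ih]
      refine prod_congr rfl fun i _ => ?_
      rw [Fin.prod_Ioi_succ]
      simp
    · rw [qPoch, Fin.val_last, ← Fin.prod_univ_eq_prod_range (fun j => 1 - q * q ^ j)]
      refine prod_congr rfl fun i _ => ?_
      rw [← pow_succ', ← zpow_natCast]
      simp

/-- The minors of the matrix of coefficients of Euler's polynomial, in product form. -/
lemma det_eulerCoeff (hq0 : q ≠ 0) (hq : ∀ m : ℕ, 0 < m → q ^ m ≠ 1) (M m : ℕ)
    (a : Fin (m + 1) → ℕ) (ha : ∀ i, a i ≤ M + m) :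
    (Matrix.of fun i j : Fin (m + 1) => eulerCoeff q M ((a i : ℤ) - (j : ℕ))).det =
      q ^ (∑ i : Fin (m + 1), ((a i : ℤ) - (i : ℕ)) * ((a i : ℤ) - (i : ℕ) - 1) / 2) *
        (∏ i, ∏ j ∈ Ioi i, (1 - q ^ ((a j : ℤ) - a i))) *
        ∏ i : Fin (m + 1), (qPoch q q (M + i) / (qPoch q q (a i) * qPoch q q (M + m - a i))) := by
  have h1 := det_eulerCoeff_mul hq M m a ha
  have h2 := det_eulerCoeff_mul hq M m (fun i => i) (fun i => by have := i.is_lt; omega)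
  rw [vandermonde_pow_det hq0] at h1 h2
  rw [det_eulerCoeff_id, mul_one, prod_Ioi_one_sub_pow] at h2
  have h3 : ∏ i : Fin (m + 1), qPoch q q (M + i) = ∏ i : Fin (m + 1), qPoch q q (M + m - i) := by
    rw [← Equiv.prod_comp Fin.revPerm]
    refine prod_congr rfl fun i _ => ?_
    rw [Fin.revPerm_apply, Fin.val_rev]
    congr 1
    have := i.is_lt
    omega
  have h4 : (∏ i : Fin (m + 1), q ^ (a i).choose 2) * (∏ i : Fin (m + 1), q ^ (a i * (m - i))) *
      (∏ i : Fin (m + 1), q ^ (m * (i : ℕ))) =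
      q ^ (∑ i : Fin (m + 1), ((a i : ℤ) - (i : ℕ)) * ((a i : ℤ) - (i : ℕ) - 1) / 2) *
        ((∏ i : Fin (m + 1), q ^ (i : ℕ).choose 2) *
          (∏ i : Fin (m + 1), q ^ ((i : ℕ) * (m - i))) * ∏ i : Fin (m + 1), q ^ (m * a i)) := by
    rw [zpow_sum_eq_prod hq0]
    simp only [← prod_mul_distrib]
    refine prod_congr rfl fun i _ => ?_
    simp only [← zpow_natCast, ← zpow_add₀ hq0]
    congr 1
    have h5 := two_mul_triangle ((a i : ℤ) - (i : ℕ))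
    have h6 := two_mul_choose_two (a i)
    have h7 := two_mul_choose_two (i : ℕ)
    push_cast [Nat.cast_sub (Nat.lt_succ_iff.mp i.is_lt)]
    linarith
  simp only [prod_mul_distrib, prod_div_distrib] at h1 h2 ⊢
  rw [← h3] at h2
  have hA := prod_ne_zero_iff.mpr fun i (_ : i ∈ univ) => qPoch_self_ne_zero hq (a i)
  have hB := prod_ne_zero_iff.mpr fun i (_ : i ∈ univ) => qPoch_self_ne_zero hq (M + m - a i)
  have hC := prod_ne_zero_iff.mpr fun (i : Fin (m + 1)) (_ : i ∈ univ) =>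
    qPoch_self_ne_zero hq (i : ℕ)
  have hX (f : Fin (m + 1) → ℕ) : ∏ i, q ^ f i ≠ 0 :=
    prod_ne_zero_iff.mpr fun i _ => pow_ne_zero _ hq0
  have hXa := hX fun i => m * a i
  have hYi := hX fun i => (i : ℕ).choose 2
  have hZi := hX fun i => (i : ℕ) * (m - i)
  rw [← mul_div_assoc, eq_div_iff (mul_ne_zero hA hB)]
  refine mul_left_cancel₀ (mul_ne_zero hC (mul_ne_zero hXa (mul_ne_zero hYi hZi))) ?_
  generalize (∏ i, ∏ j ∈ Ioi i, (1 - q ^ ((a j : ℤ) - a i))) = V at *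
  generalize (∏ i : Fin (m + 1), qPoch q q (M + i)) = S at *
  linear_combination (∏ i : Fin (m + 1), qPoch q q (i : ℕ)) *
      (∏ i : Fin (m + 1), q ^ (i : ℕ).choose 2) * (∏ i : Fin (m + 1), q ^ ((i : ℕ) * (m - i))) * h1 -
    (∏ i : Fin (m + 1), q ^ (a i).choose 2) * (∏ i : Fin (m + 1), q ^ (a i * (m - i))) * V * h2 +
    (∏ i : Fin (m + 1), qPoch q q (i : ℕ)) * V * S * h4

end EulerDeterminant

section SeriesSide

variable {F : Type*} [Field F] {q : F}

lemma det_eulerCoeff_eq_zero {M m : ℕ} {a : Fin (m + 1) → ℤ}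
    (ha : ∃ i, a i < 0 ∨ (M : ℤ) + m < a i) :
    (Matrix.of fun i j : Fin (m + 1) => eulerCoeff q M (a i - (j : ℕ))).det = 0 := by
  obtain ⟨i, hi⟩ := ha
  refine Matrix.det_eq_zero_of_row_eq_zero i fun j => ?_
  have := j.is_lt
  rcases hi with hi | hi
  · exact eulerCoeff_of_neg q (by omega)
  · exact eulerCoeff_of_gt q (by omega)

/-- The change of variables `k ↦ k + m₁` in the quadratic exponent. -/
lemma thetaExponent_add_const {m m1 : ℕ} {k : Fin (m + 1) → ℤ} (hk : ∑ i, k i = 0) :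
    (((m + 1 + 1).choose 2 : ℕ) : ℤ) * (∑ i, (k i) ^ 2) +
        ∑ i : Fin (m + 1), (((i : ℕ) : ℤ) + 1) * k i +
        ((m : ℤ) + 2) * ((((m + 1) * m1).choose 2 : ℕ) : ℤ) =
      thetaExponent m (fun i => k i + m1) +
        ∑ i, (((m : ℤ) + 1) * (k i + m1)) * (((m : ℤ) + 1) * (k i + m1) - 1) / 2 := by
  have h1 := two_mul_choose_two (m + 1 + 1)
  have h2 := two_mul_choose_two ((m + 1) * m1)
  have h3 : 2 * thetaExponent m (fun i => k i + m1) = ∑ i : Fin (m + 1),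
      (((m : ℤ) + 1) * ((k i + m1) * (k i + m1 - 1)) + 2 * ((i : ℕ) * (k i + m1))) := by
    rw [thetaExponent, mul_sum]
    exact sum_congr rfl fun i _ => by linear_combination ((m : ℤ) + 1) * two_mul_triangle (k i + m1)
  have h4 : 2 * ∑ i, (((m : ℤ) + 1) * (k i + m1)) * (((m : ℤ) + 1) * (k i + m1) - 1) / 2 =
      ∑ i, (((m : ℤ) + 1) * (k i + m1)) * (((m : ℤ) + 1) * (k i + m1) - 1) := by
    rw [mul_sum]
    exact sum_congr rfl fun i _ => two_mul_triangle _
  have h5 : 2 * ∑ i : Fin (m + 1), ((i : ℕ) : ℤ) = ((m : ℤ) + 1) * m := by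
    rw [Fin.sum_univ_eq_sum_range (fun i => (i : ℤ)), ← Nat.cast_sum, mul_comm,
      ← Nat.cast_ofNat (n := 2), ← Nat.cast_mul, sum_range_id_mul_two]
    simp
  have h6 : ∑ i : Fin (m + 1), (((m : ℤ) + 1) * ((k i + m1) * (k i + m1 - 1)) +
        2 * ((i : ℕ) * (k i + m1))) +
      ∑ i, (((m : ℤ) + 1) * (k i + m1)) * (((m : ℤ) + 1) * (k i + m1) - 1) -
      ((m : ℤ) + 2) * (m + 1) * ∑ i, (k i) ^ 2 -
      2 * ∑ i : Fin (m + 1), (((i : ℕ) : ℤ) + 1) * k i =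
      ((m : ℤ) + 1) * (((m : ℤ) + 2) * (m + 1) * m1 ^ 2 - 2 * (m + 1) * m1) +
        2 * m1 * ∑ i : Fin (m + 1), ((i : ℕ) : ℤ) := by
    have h7 : ∑ i, (2 * ((m : ℤ) + 2) * (m + 1) * m1 - 2 * (m + 1) - 2) * k i = 0 := by
      rw [← mul_sum, hk, mul_zero]
    have h8 : ((m : ℤ) + 1) * (((m : ℤ) + 2) * (m + 1) * m1 ^ 2 - 2 * (m + 1) * m1) =
        ∑ _i : Fin (m + 1), (((m : ℤ) + 2) * (m + 1) * m1 ^ 2 - 2 * (m + 1) * m1) := by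
      rw [sum_const, card_univ, Fintype.card_fin, nsmul_eq_mul, Nat.cast_succ]
    rw [h8, ← add_zero (_ + 2 * (m1 : ℤ) * _), ← h7]
    simp only [mul_sum, ← sum_add_distrib, ← sum_sub_distrib]
    exact sum_congr rfl fun i _ => by ring
  push_cast at h1 h2
  refine mul_left_cancel₀ (two_ne_zero (α := ℤ)) ?_
  rw [mul_add 2 (thetaExponent _ _), h3, h4]
  linear_combination (∑ i, (k i) ^ 2) * h1 + ((m : ℤ) + 2) * h2 - h6 - (m1 : ℤ) * h5

lemma prod_filter_lt_eq_prod_Ioi {m : ℕ} (f : Fin m → Fin m → F) :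
    ∏ j, ∏ i ∈ univ.filter (fun i => i < j), f i j = ∏ i, ∏ j ∈ Ioi i, f i j :=
  prod_comm' (by simp)

/-- Warnaar's multiple series in terms of `thetaEulerSum`. -/
lemma finsum_eq_thetaEulerSum (hq0 : q ≠ 0) (hq : ∀ m : ℕ, 0 < m → q ^ m ≠ 1) (m m1 M2 : ℕ) :
    q ^ ((m + 2) * ((m + 1) * m1).choose 2) * (∑ᶠ k : Fin (m + 1) → ℤ,
      if (∑ i, k i) = 0 ∧
          ∀ i : Fin (m + 1), 0 ≤ (((m + 1) * m1 : ℕ) : ℤ) + (m + 1 : ℕ) * k i + (i : ℕ) ∧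
            0 ≤ (M2 : ℤ) - (m + 1 : ℕ) * k i + (m + 1 : ℕ) - ((i : ℕ) + 1) then
        q ^ ((((m + 1 + 1).choose 2 : ℕ) : ℤ) * (∑ i, (k i) ^ 2) +
              ∑ i : Fin (m + 1), (((i : ℕ) : ℤ) + 1) * k i) *
          (∏ j : Fin (m + 1), ∏ i ∈ Finset.univ.filter (fun i : Fin (m + 1) => i < j),
            (1 - q ^ (((m + 1 : ℕ) : ℤ) * k j - ((m + 1 : ℕ) : ℤ) * k i +
              ((j : ℕ) : ℤ) - ((i : ℕ) : ℤ)))) *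
          ∏ i : Fin (m + 1),
            qPoch q q ((m + 1) * m1 + M2 + (i : ℕ)) /
              (qPoch q q ((((m + 1) * m1 : ℕ) : ℤ) + (m + 1 : ℕ) * k i + (i : ℕ)).toNat *
                qPoch q q ((M2 : ℤ) - (m + 1 : ℕ) * k i + (m + 1 : ℕ) - ((i : ℕ) + 1)).toNat)
      else 0) = thetaEulerSum q m ((m + 1) * m1 + M2) (((m + 1) * m1 : ℕ) : ℤ) := by
  symm
  rw [thetaEulerSum, thetaDetSum, mul_finsum,
    ← finsum_comp_equiv (Equiv.addRight fun _ : Fin (m + 1) => (m1 : ℤ))]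
  refine finsum_congr fun k => ?_
  symm
  have hsum : (∑ i, Equiv.addRight (fun _ : Fin (m + 1) => (m1 : ℤ)) k i =
      (((m + 1) * m1 : ℕ) : ℤ)) ↔ ∑ i, k i = 0 := by
    simp [sum_add_distrib]
  by_cases hk : ∑ i, k i = 0
  swap
  · rw [if_neg (fun h => hk h.1), if_neg (fun h => hk (hsum.mp h)), mul_zero]
  rw [if_pos (hsum.mpr hk)]
  simp only [Equiv.coe_addRight, Pi.add_apply]
  split_ifs with h
  · obtain ⟨a, ha⟩ : ∃ a : Fin (m + 1) → ℕ,
        ∀ i, (a i : ℤ) = ((m : ℤ) + 1) * (k i + m1) + (i : ℕ) := by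
      refine ⟨fun i => (((m : ℤ) + 1) * (k i + m1) + (i : ℕ)).toNat, fun i => ?_⟩
      have := (h.2 i).1
      push_cast at this
      exact Int.toNat_of_nonneg (by linarith)
    have hle : ∀ i, a i ≤ (m + 1) * m1 + M2 + m := fun i => by
      have := (h.2 i).2
      zify
      rw [ha]
      push_cast at this
      linarith
    have hdet := det_eulerCoeff hq0 hq ((m + 1) * m1 + M2) m a hle
    simp only [← ha]
    rw [hdet, prod_filter_lt_eq_prod_Ioi fun i j => (1 - q ^ (((m + 1 : ℕ) : ℤ) * k j -
      ((m + 1 : ℕ) : ℤ) * k i + ((j : ℕ) : ℤ) - ((i : ℕ) : ℤ))), ← mul_assoc, ← mul_assoc,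
      ← mul_assoc, ← mul_assoc, ← zpow_natCast q ((m + 2) * _), ← zpow_add₀ hq0, ← zpow_add₀ hq0]
    congr 1
    · congr 1
      · congr 1
        have := thetaExponent_add_const (m1 := m1) hk
        simp only [ha, add_sub_cancel_right]
        refine Eq.trans ?_ this
        push_cast
        ring
      · refine prod_congr rfl fun i _ => prod_congr rfl fun j _ => ?_
        rw [ha, ha]
        push_cast
        ring_nf
    · refine prod_congr rfl fun i _ => ?_
      congr 3
      · rw [← Nat.cast_inj (R := ℤ), Int.toNat_of_nonneg (h.2 i).1, ha]
        push_cast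
        ring
      · rw [← Nat.cast_inj (R := ℤ), Int.toNat_of_nonneg (h.2 i).2, Nat.cast_sub (hle i), ha]
        push_cast
        ring
  · rw [det_eulerCoeff_eq_zero, mul_zero, mul_zero]
    by_contra! h'
    refine h ⟨hk, fun i => ?_⟩
    have := h' i
    push_cast at this ⊢
    constructor <;> nlinarith

end SeriesSide

section CyclicShift

variable (F : Type*) [Field F]

/-- The matrix of the cyclic shift `e_t ↦ e_{t+1}` on `n = m + 1` letters. -/
def cyclicShift (m : ℕ) : Matrix (Fin (m + 1)) (Fin (m + 1)) F :=
  Matrix.of fun r t => if r = t + 1 then 1 else 0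

variable {F} {m : ℕ}

open Matrix Polynomial

lemma succ_eq_add_one_iff (r : Fin m) (x : Fin (m + 1)) : r.succ = x + 1 ↔ x = r.castSucc := by
  rw [← Fin.coeSucc_eq_succ, add_left_inj, eq_comm]

lemma cyclicShift_mul_apply_zero (A : Matrix (Fin (m + 1)) (Fin (m + 1)) F) (t : Fin (m + 1)) :
    (cyclicShift F m * A) 0 t = A (Fin.last m) t := by
  have (x : Fin (m + 1)) : 0 = x + 1 ↔ x = Fin.last m := by
    rw [← Fin.last_add_one m, add_left_inj, eq_comm]
  simp [cyclicShift, mul_apply, this]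

lemma cyclicShift_mul_apply_succ (A : Matrix (Fin (m + 1)) (Fin (m + 1)) F) (r : Fin m)
    (t : Fin (m + 1)) : (cyclicShift F m * A) r.succ t = A r.castSucc t := by
  simp [cyclicShift, mul_apply, succ_eq_add_one_iff]

lemma cyclicShift_pow_apply (y : ℕ) (r t : Fin (m + 1)) :
    (cyclicShift F m ^ y) r t = if (r : ℕ) = (t + y) % (m + 1) then 1 else 0 := by
  induction y generalizing t with
  | zero => simp [one_apply, Fin.ext_iff, Nat.mod_eq_of_lt t.is_lt]
  | succ y ih =>
    rw [pow_succ, mul_apply]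
    simp only [ih]
    simp [cyclicShift, Fin.val_add, add_assoc, add_comm 1 y]

lemma aeval_cyclicShift_mulVec_one (p : F[X]) :
    aeval (cyclicShift F m) p *ᵥ 1 = p.eval 1 • (1 : Fin (m + 1) → F) := by
  have h1 : cyclicShift F m *ᵥ 1 = 1 := by
    ext r
    have (x : Fin (m + 1)) : r = x + 1 ↔ x = r - 1 := by
      rw [eq_sub_iff_add_eq, eq_comm]
    simp [cyclicShift, mulVec, dotProduct, this]
  induction p using Polynomial.induction_on' with
  | add p r hp hr => simp [add_mulVec, hp, hr, add_smul]
  | monomial y c =>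
    have h2 : cyclicShift F m ^ y *ᵥ 1 = 1 := by
      induction y with
      | zero => simp
      | succ y ih => rw [pow_succ, ← mulVec_mulVec, h1, ih]
    simp [aeval_monomial, h2, Algebra.algebraMap_eq_smul_one, smul_mulVec]

lemma adjugate_one_sub_smul_cyclicShift (c : F) (r : Fin (m + 1)) :
    (1 - c • cyclicShift F m).adjugate r 0 = c ^ (r : ℕ) := by
  induction r using Fin.induction with
  | zero =>
    rw [adjugate_apply, det_of_isLowerTriangular]
    · have (i : Fin m) : i.succ ≠ i.succ + 1 := fun h =>
        i.castSucc_lt_succ.ne' ((succ_eq_add_one_iff i _).mp h)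
      simp [Fin.prod_univ_succ, cyclicShift, this]
    · intro i j hij
      have hij : i < j := hij
      induction i using Fin.cases with
      | zero => simp [hij.ne']
      | succ i =>
        have h1 : i.succ ≠ j + 1 := fun h =>
          (i.castSucc_lt_succ.trans hij).ne' ((succ_eq_add_one_iff i _).mp h)
        simp [cyclicShift, hij.ne, h1]
  | succ r ih =>
    have h := congrFun₂ (mul_adjugate (1 - c • cyclicShift F m)) r.succ 0
    rw [sub_mul, Matrix.sub_apply, one_mul, smul_mul, Matrix.smul_apply,
      cyclicShift_mul_apply_succ, ih] at h
    simp only [Matrix.smul_apply, one_apply_ne (Fin.succ_ne_zero r), smul_eq_mul, mul_zero] at h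
    rw [Fin.val_succ, pow_succ']
    exact sub_eq_zero.mp h

lemma det_one_sub_smul_cyclicShift (c : F) :
    (1 - c • cyclicShift F m).det = 1 - c ^ (m + 1) := by
  have h := congrFun₂ (mul_adjugate (1 - c • cyclicShift F m)) 0 0
  rw [sub_mul, Matrix.sub_apply, one_mul, smul_mul, Matrix.smul_apply, cyclicShift_mul_apply_zero,
    adjugate_one_sub_smul_cyclicShift, adjugate_one_sub_smul_cyclicShift] at h
  simpa [pow_succ'] using h.symm

lemma adjugate_aeval_cyclicShift {h : F[X]} (h1 : h.eval 1 ≠ 0) :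
    (aeval (cyclicShift F m) ((1 - X) * h)).adjugate 0 0 =
      (aeval (cyclicShift F m) h).det / h.eval 1 := by
  have hadj (j : Fin (m + 1)) : (1 - cyclicShift F m).adjugate j 0 = 1 := by
    simpa using adjugate_one_sub_smul_cyclicShift (1 : F) j
  have h2 : (aeval (cyclicShift F m) h).adjugate *ᵥ (aeval (cyclicShift F m) h *ᵥ 1) =
      (aeval (cyclicShift F m) h).det • 1 := by
    rw [mulVec_mulVec, adjugate_mul, smul_mulVec, one_mulVec]
  rw [aeval_cyclicShift_mulVec_one, mulVec_smul] at h2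
  have h3 := congrFun h2 0
  simp only [Pi.smul_apply, smul_eq_mul, Pi.one_apply, mul_one] at h3
  rw [eq_div_iff h1, ← h3, map_mul, adjugate_mul_distrib, map_sub, map_one, aeval_X, mul_apply,
    mul_comm]
  simp [hadj, mulVec, dotProduct]

lemma det_aeval_cyclicShift_prod {ι : Type*} (s : Finset ι) (c : ι → F) :
    (aeval (cyclicShift F m) (∏ i ∈ s, (1 - C (c i) * X))).det = ∏ i ∈ s, (1 - c i ^ (m + 1)) := by
  have := map_prod ((detMonoidHom (R := F) (n := Fin (m + 1))).comp
      (aeval (cyclicShift F m) : F[X] →ₐ[F] Matrix (Fin (m + 1)) (Fin (m + 1)) F).toRingHom.toMonoidHom)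
    (fun i => 1 - C (c i) * X) s
  simp only [MonoidHom.comp_apply, coe_detMonoidHom] at this
  refine this.trans (prod_congr rfl fun i _ => ?_)
  rw [← det_one_sub_smul_cyclicShift]
  congr 1
  simp [Algebra.algebraMap_eq_smul_one]

lemma aeval_cyclicShift_apply_zero {p : F[X]} {K : ℕ} (hp : p.natDegree < (m + 1) * K)
    (r : Fin (m + 1)) :
    aeval (cyclicShift F m) p r 0 = ∑ k ∈ range K, p.coeff ((m + 1) * k + r) := by
  rw [aeval_eq_sum_range' hp, Matrix.sum_apply]
  simp only [Matrix.smul_apply, cyclicShift_pow_apply, Fin.val_zero, zero_add,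
    smul_eq_mul, mul_ite, mul_one, mul_zero]
  clear hp
  induction K with
  | zero => simp
  | succ K ih =>
    rw [mul_add, mul_one, sum_range_add, ih, sum_range_succ (fun k => p.coeff ((m + 1) * k + r))]
    congr 1
    rw [sum_eq_single (r : ℕ)]
    · simp [Nat.mod_eq_of_lt r.is_lt]
    · intro t ht hr
      rw [mem_range] at ht
      simp [Nat.mod_eq_of_lt ht, hr.symm]
    · exact fun h => absurd (mem_range.mpr r.is_lt) h

end CyclicShift

section ResidueDeterminant

variable {F : Type*} [Field F] {m : ℕ}

open Matrix Polynomial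

/-- The leading coefficients of a family of multiples of `G` have the same determinant as those of
the family of quotients. -/
lemma det_coeff_mul {G : F[X]} (hG : G.coeff 0 = 1) (f : Fin (m + 1) → F[X]) :
    (Matrix.of fun t s : Fin (m + 1) => (G * f s).coeff t).det =
      (Matrix.of fun t s : Fin (m + 1) => (f s).coeff t).det := by
  have h : (Matrix.of fun t s : Fin (m + 1) => (G * f s).coeff t) =
      (Matrix.of fun t u : Fin (m + 1) => if u ≤ t then G.coeff (t - u) else 0) *
        Matrix.of fun t s : Fin (m + 1) => (f s).coeff t := by
    ext t s
    simp only [of_apply, mul_apply, ite_mul, zero_mul]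
    rw [mul_comm, coeff_mul, Finset.Nat.sum_antidiagonal_eq_sum_range_succ
      (fun i j => (f s).coeff i * G.coeff j)]
    simp only [Fin.le_def]
    rw [Fin.sum_univ_eq_sum_range
      (fun u => if u ≤ (t : ℕ) then G.coeff (t - u) * (f s).coeff u else 0), ← sum_filter]
    refine sum_congr ?_ fun u _ => mul_comm _ _
    ext u
    have := t.is_lt
    simp only [mem_range, mem_filter]
    omega
  rw [h, det_mul, det_of_isLowerTriangular, prod_eq_one, one_mul]
  · simp [hG]
  · intro t u (htu : t < u)
    simp [htu]

/-- The determinant of the residue-class sums of coefficients of the multiples `G * f s`, with the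
row of the class `0` replaced by ones. -/
lemma det_cons_one_residue {G : F[X]} (hG : G.coeff 0 = 1) {f : Fin (m + 1) → F[X]}
    (hf : ∀ s, (f s).natDegree ≤ m) (hf0 : ∀ s, (f s).coeff 0 = 1) :
    (Matrix.of (Fin.cons (fun _ => 1)
        fun (r : Fin m) s => aeval (cyclicShift F m) (G * f s) r.succ 0)).det =
      (aeval (cyclicShift F m) G).adjugate 0 0 *
        (Matrix.of fun t s : Fin (m + 1) => (G * f s).coeff t).det := by
  have hcol (s t : Fin (m + 1)) : aeval (cyclicShift F m) (f s) t 0 = (f s).coeff t := by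
    rw [aeval_cyclicShift_apply_zero (K := 1) (by have := hf s; omega)]
    simp
  rw [det_coeff_mul hG, adjugate_apply, ← det_mul]
  congr 1
  ext r s
  induction r using Fin.cases with
  | zero => simp [mul_apply, Pi.single_apply, hf0]
  | succ r =>
    rw [mul_apply]
    simp [mul_apply, hcol]

lemma det_cons_sum {ι : Type*} [DecidableEq ι] (v : Fin (m + 1) → F) (S : Finset ι)
    (g : Fin m → ι → Fin (m + 1) → F) :
    (Matrix.of (Fin.cons v fun r s => ∑ k ∈ S, g r k s)).det =
      ∑ k ∈ Fintype.piFinset fun _ : Fin m => S,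
        (Matrix.of (Fin.cons v fun r => g r (k r))).det := by
  have h := MultilinearMap.map_sum_finset
    ((detRowAlternating (n := Fin (m + 1)) (R := F)).toMultilinearMap.curryLeft v) g (fun _ => S)
  have h1 : (fun r s => ∑ k ∈ S, g r k s) = fun r => ∑ k ∈ S, g r k := by
    ext r s
    simp
  rw [h1]
  exact h

lemma sum_det_cons_coeff {G : F[X]} (hG : G.coeff 0 = 1) {f : Fin (m + 1) → F[X]}
    (hf : ∀ s, (f s).natDegree ≤ m) (hf0 : ∀ s, (f s).coeff 0 = 1) {K : ℕ}
    (hK : ∀ s, (G * f s).natDegree < (m + 1) * K) :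
    ∑ k ∈ Fintype.piFinset fun _ : Fin m => range K, (Matrix.of (Fin.cons (fun _ => 1)
        fun (r : Fin m) s => (G * f s).coeff ((m + 1) * k r + r.succ))).det =
      (aeval (cyclicShift F m) G).adjugate 0 0 *
        (Matrix.of fun t s : Fin (m + 1) => (G * f s).coeff t).det := by
  rw [← det_cons_one_residue hG hf hf0,
    ← det_cons_sum _ _ fun (r : Fin m) k s => (G * f s).coeff ((m + 1) * k + r.succ)]
  simp only [aeval_cyclicShift_apply_zero (hK _)]

end ResidueDeterminant

section ProductSide

variable {F : Type*} [Field F] {q : F}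

open Matrix Polynomial

/-- The polynomial `∏_{i<N} (1 - q^(e+i) X)`. -/
noncomputable def shiftedEulerPoly (q : F) (e : ℤ) (N : ℕ) : F[X] :=
  ∏ i ∈ range N, (1 - C (q ^ (e + i)) * X)

lemma shiftedEulerPoly_add (e : ℤ) (a b : ℕ) :
    shiftedEulerPoly q e (a + b) = shiftedEulerPoly q e a * shiftedEulerPoly q (e + a) b := by
  simp [shiftedEulerPoly, prod_range_add, add_assoc]

lemma shiftedEulerPoly_coeff_zero (e : ℤ) (N : ℕ) : (shiftedEulerPoly q e N).coeff 0 = 1 := by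
  simp [shiftedEulerPoly, coeff_zero_prod]

lemma shiftedEulerPoly_natDegree_le (e : ℤ) (N : ℕ) : (shiftedEulerPoly q e N).natDegree ≤ N := by
  refine (natDegree_prod_le _ _).trans ?_
  refine (Finset.sum_le_card_nsmul _ _ 1 fun i _ => ?_).trans (by simp)
  compute_degree

lemma shiftedEulerPoly_coeff (hq0 : q ≠ 0) (e : ℤ) (N y : ℕ) :
    (shiftedEulerPoly q e N).coeff y = (-q ^ e) ^ y * (eulerPoly q N).coeff y := by
  have : shiftedEulerPoly q e N = (eulerPoly q N).comp (C (-q ^ e) * X) := by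
    rw [shiftedEulerPoly, eulerPoly, Polynomial.prod_comp]
    refine prod_congr rfl fun i _ => ?_
    simp only [zpow_add₀ hq0, zpow_natCast, add_comp, mul_comp, one_comp, C_comp, X_comp, C_mul,
      C_neg]
    ring
  rw [this, comp_C_mul_X_coeff, mul_comm]

lemma eval_one_shiftedEulerPoly (hq0 : q ≠ 0) (e : ℤ) (N : ℕ) :
    (shiftedEulerPoly q e N).eval 1 = qPoch q (q ^ e) N := by
  simp [shiftedEulerPoly, qPoch, eval_prod, zpow_add₀ hq0]

lemma det_aeval_shiftedEulerPoly (hq0 : q ≠ 0) (m : ℕ) (e : ℤ) (N : ℕ) :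
    (aeval (cyclicShift F m) (shiftedEulerPoly q e N)).det =
      qPoch (q ^ (m + 1)) (q ^ ((m + 1 : ℕ) * e)) N := by
  rw [shiftedEulerPoly, det_aeval_cyclicShift_prod, qPoch]
  refine prod_congr rfl fun i _ => ?_
  rw [zpow_add₀ hq0, mul_pow, zpow_natCast, ← pow_mul, ← pow_mul, mul_comm i, mul_comm _ e,
    _root_.zpow_mul, zpow_natCast]

/-- The cofactor attached to the product `∏_{j=-M₁}^{M₂} (1 - q^j X)`. -/
lemma adjugate_aeval_shiftedEulerPoly (hq0 : q ≠ 0) (m M1 M2 : ℕ)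
    (h1 : qPoch q (q ^ (-(M1 : ℤ))) M1 ≠ 0) (h2 : qPoch q q M2 ≠ 0) :
    (aeval (cyclicShift F m) (shiftedEulerPoly q (-M1) (M1 + M2 + 1))).adjugate 0 0 =
      qPoch (q ^ (m + 1)) (q ^ (-((m + 1 : ℕ) : ℤ) * M1)) M1 *
        qPoch (q ^ (m + 1)) (q ^ (m + 1)) M2 /
        (qPoch q (q ^ (-(M1 : ℤ))) M1 * qPoch q q M2) := by
  have hG : shiftedEulerPoly q (-M1) (M1 + M2 + 1) =
      (1 - X) * (shiftedEulerPoly q (-M1) M1 * shiftedEulerPoly q 1 M2) := by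
    rw [show M1 + M2 + 1 = M1 + (1 + M2) by ring, shiftedEulerPoly_add, neg_add_cancel,
      shiftedEulerPoly_add, zero_add, Nat.cast_one]
    simp only [shiftedEulerPoly, prod_range_one, Nat.cast_zero, add_zero, zpow_zero, C_1]
    ring
  have heval : (shiftedEulerPoly q (-M1) M1 * shiftedEulerPoly q 1 M2).eval 1 =
      qPoch q (q ^ (-(M1 : ℤ))) M1 * qPoch q q M2 := by
    rw [eval_mul, eval_one_shiftedEulerPoly hq0, eval_one_shiftedEulerPoly hq0, zpow_one]
  rw [hG, adjugate_aeval_cyclicShift (by rw [heval]; exact mul_ne_zero h1 h2), heval, map_mul,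
    det_mul, det_aeval_shiftedEulerPoly hq0, det_aeval_shiftedEulerPoly hq0, mul_one, zpow_natCast,
    mul_neg, neg_mul]

lemma qPoch_zpow_neg (hq0 : q ≠ 0) (M : ℕ) :
    q ^ (M + 1).choose 2 * qPoch q (q ^ (-(M : ℤ))) M = (-1) ^ M * qPoch q q M := by
  have h (j : ℕ) : q ^ (j + 1) * qPoch q (q ^ (-((j + 1 : ℕ) : ℤ))) (j + 1) =
      -(1 - q * q ^ j) * qPoch q (q ^ (-(j : ℤ))) j := by
    rw [add_comm j 1, qPoch_add]
    have : q ^ (-((1 + j : ℕ) : ℤ)) * q ^ 1 = q ^ (-(j : ℤ)) := by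
      rw [pow_one, ← zpow_add_one₀ hq0]
      congr 1
      push_cast
      ring
    rw [this, ← mul_assoc]
    congr 1
    rw [qPoch, prod_range_one, pow_zero, mul_one, mul_sub, _root_.zpow_neg, zpow_natCast,
      mul_inv_cancel₀ (pow_ne_zero _ hq0)]
    ring
  induction M with
  | zero => simp [qPoch_zero]
  | succ M ih =>
    rw [Nat.choose_succ_succ' (M + 1) 1, Nat.choose_one_right, pow_add, qPoch_succ q M]
    linear_combination q ^ (M + 1).choose 2 * h M - (1 - q * q ^ M) * ih

lemma eulerPoly_coeff_succ_mul (N y : ℕ) :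
    (1 - q ^ (y + 1)) * (eulerPoly q N).coeff (y + 1) =
      (q ^ y - q ^ N) * (eulerPoly q N).coeff y := by
  have h : (1 + X) * (eulerPoly q N).comp (C q * X) = eulerPoly q N * (1 + C (q ^ N) * X) := by
    rw [← eulerPoly_succ_eq, eulerPoly, prod_range_succ, ← eulerPoly]
  have h1 := congrArg (fun p => p.coeff (y + 1)) h
  simp only [add_mul, mul_add, one_mul, mul_one, coeff_add, coeff_X_mul, comp_C_mul_X_coeff,
    ← mul_assoc, coeff_mul_X, coeff_mul_C] at h1
  linear_combination -h1

/-- The contribution of a single row to the ratio of determinants. -/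
lemma eulerPoly_coeff_ratio (hq0 : q ≠ 0) (M1 M2 m a K : ℕ) :
    (-q ^ (-((M1 : ℤ) + m))) ^ K * (eulerPoly q (M1 + M2 + m + 1)).coeff (K + a) *
        (1 - q ^ (-((K + a : ℕ) : ℤ))) * qPoch q (q ^ a) K =
      (eulerPoly q (M1 + M2 + m + 1)).coeff a * (1 - q ^ (-(a : ℤ))) *
        (qPoch q (q ^ (-(M1 : ℤ) - M2 - (m + 1 : ℕ) + a)) K * q ^ (M2 * K)) := by
  induction K with
  | zero => simp [qPoch_zero]
  | succ K ih =>
    have h := eulerPoly_coeff_succ_mul (q := q) (M1 + M2 + m + 1) (K + a)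
    rw [qPoch_succ, qPoch_succ, mul_add M2, mul_one, pow_add q (M2 * K),
      show K + 1 + a = K + a + 1 by ring]
    have h1 : 1 - q ^ (-((K + a + 1 : ℕ) : ℤ)) =
        -(q ^ (K + a + 1))⁻¹ * (1 - q ^ (K + a + 1)) := by
      rw [_root_.zpow_neg, zpow_natCast]
      field_simp
      ring
    have h2 : 1 - q ^ a * q ^ K = - q ^ (K + a) * (1 - q ^ (-((K + a : ℕ) : ℤ))) := by
      rw [_root_.zpow_neg, zpow_natCast]
      field_simp
      ring
    have h3 : q ^ (-((M1 : ℤ) + m)) * (q ^ (K + a + 1))⁻¹ * q ^ (K + a) *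
        (q ^ (K + a) - q ^ (M1 + M2 + m + 1)) =
        - ((1 - q ^ (-(M1 : ℤ) - M2 - (m + 1 : ℕ) + a) * q ^ K) * q ^ M2) := by
      have h4 : q ^ (-(M1 : ℤ) - M2 - (m + 1 : ℕ) + a) =
        q ^ a * (q ^ M1)⁻¹ * (q ^ M2)⁻¹ * (q ^ (m + 1))⁻¹ := by
        simp only [← zpow_natCast, ← _root_.zpow_neg, ← zpow_add₀ hq0]
        congr 1
        push_cast
        ring
      have h5 : q ^ (-((M1 : ℤ) + m)) = (q ^ M1)⁻¹ * (q ^ m)⁻¹ := by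
        simp only [← zpow_natCast, ← _root_.zpow_neg, ← zpow_add₀ hq0]
        congr 1
        ring
      rw [h4, h5]
      field_simp
      ring
    rw [h1, h2, pow_succ]
    generalize hw : (q ^ (K + a + 1))⁻¹ = w at h3 ⊢
    generalize hz : q ^ (-((M1 : ℤ) + m)) = z at ih h3 ⊢
    linear_combination
      (-(-z) ^ K * z * w * q ^ (K + a) * qPoch q (q ^ a) K * (1 - q ^ (-((K + a : ℕ) : ℤ)))) * h -
      ((-z) ^ K * (eulerPoly q (M1 + M2 + m + 1)).coeff (K + a) *
        (1 - q ^ (-((K + a : ℕ) : ℤ))) * qPoch q (q ^ a) K) * h3 +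
      ((1 - q ^ (-(M1 : ℤ) - M2 - (m + 1 : ℕ) + a) * q ^ K) * q ^ M2) * ih

end ProductSide

section EntangledSum

variable {F : Type*} [Field F] {q : F}

open Matrix Polynomial

lemma det_vandermonde_cons_one (hq0 : q ≠ 0) {m : ℕ} (y : Fin m → ℕ) :
    (vandermonde (Fin.cons 1 fun r => q ^ y r : Fin (m + 1) → F)).det =
      (∏ s : Fin m, q ^ (y s * ((s : ℕ) + 1)) * (1 - q ^ (-(y s : ℤ)))) *
        ∏ s : Fin m, ∏ r ∈ univ.filter (fun r => r < s), (1 - q ^ ((y r : ℤ) - y s)) := by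
  have h (a b : ℕ) : q ^ b - q ^ a = q ^ b * (1 - q ^ ((a : ℤ) - b)) := by
    rw [zpow_sub₀ hq0, zpow_natCast, zpow_natCast]
    field_simp
  have h0 (b : ℕ) : q ^ b - 1 = q ^ b * (1 - q ^ (-(b : ℤ))) := by
    simpa using h 0 b
  have hcard (s : Fin m) : (univ.filter fun r => r < s).card = s := by
    rw [filter_gt_eq_Iio, Fin.card_Iio]
  rw [det_vandermonde, Fin.prod_univ_succ, Fin.prod_Ioi_zero]
  simp only [Fin.prod_Ioi_succ, Fin.cons_zero, Fin.cons_succ]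
  rw [← prod_filter_lt_eq_prod_Ioi fun r s => q ^ y s - q ^ y r]
  simp only [h, h0, prod_mul_distrib, prod_const, hcard, mul_add, mul_one, pow_add, pow_mul]
  ring

lemma det_shiftedEulerPoly_coeff (hq0 : q ≠ 0) {m : ℕ} (d : ℤ) (N : ℕ) (y : Fin m → ℕ) :
    (Matrix.of (Fin.cons (fun _ => 1) fun (r : Fin m) (s : Fin (m + 1)) =>
        (shiftedEulerPoly q ((s : ℕ) + d) N).coeff (y r))).det =
      (∏ r, (-q ^ d) ^ y r * (eulerPoly q N).coeff (y r) *
        (q ^ (y r * ((r : ℕ) + 1)) * (1 - q ^ (-(y r : ℤ))))) *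
        ∏ s : Fin m, ∏ r ∈ univ.filter (fun r => r < s), (1 - q ^ ((y r : ℤ) - y s)) := by
  have h : (Matrix.of (Fin.cons (fun _ => 1) fun (r : Fin m) (s : Fin (m + 1)) =>
        (shiftedEulerPoly q ((s : ℕ) + d) N).coeff (y r))) =
      Matrix.of fun i j => (Fin.cons 1 fun r => (-q ^ d) ^ y r * (eulerPoly q N).coeff (y r) :
        Fin (m + 1) → F) i * vandermonde (Fin.cons 1 fun r => q ^ y r : Fin (m + 1) → F) i j := by
    ext i j
    refine Fin.cases ?_ (fun r => ?_) i
    · simp [vandermonde_apply]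
    · simp only [of_apply, Fin.cons_succ, vandermonde_apply, shiftedEulerPoly_coeff hq0,
        zpow_add₀ hq0, zpow_natCast]
      rw [← mul_neg, mul_pow, ← pow_mul, ← pow_mul, mul_comm (j : ℕ)]
      ring
  rw [h, det_mul_column, Fin.prod_univ_succ, det_vandermonde_cons_one hq0, ← mul_assoc]
  simp only [Fin.cons_zero, Fin.cons_succ, one_mul, prod_mul_distrib]

lemma qPoch_pow_ne_zero (hq : ∀ m : ℕ, 0 < m → q ^ m ≠ 1) {a : ℕ} (ha : 0 < a) (K : ℕ) :
    qPoch q (q ^ a) K ≠ 0 := by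
  refine prod_ne_zero_iff.mpr fun j _ => ?_
  rw [← pow_add]
  exact one_sub_pow_ne_zero hq (by omega)

lemma one_sub_zpow_ne_zero (hq : ∀ m : ℕ, 0 < m → q ^ m ≠ 1) {a : ℤ} (ha : a < 0) :
    1 - q ^ a ≠ 0 := by
  obtain ⟨b, rfl⟩ := Int.eq_ofNat_of_zero_le (show 0 ≤ -a by omega) |>.imp fun b hb =>
    (neg_eq_iff_eq_neg.mp hb)
  rw [_root_.zpow_neg, zpow_natCast, sub_ne_zero, ne_comm, Ne, inv_eq_one]
  exact hq b (by omega)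

/-- The summand of the entangled sum as a ratio of determinants. -/
lemma det_shiftedEulerPoly_coeff_eq_mul (hq0 : q ≠ 0) (hq : ∀ m : ℕ, 0 < m → q ^ m ≠ 1)
    (m M1 M2 : ℕ) (k : Fin m → ℕ) :
    (Matrix.of (Fin.cons (fun _ => 1) fun (r : Fin m) (s : Fin (m + 1)) =>
        (shiftedEulerPoly q ((s : ℕ) + -((M1 : ℤ) + m)) (M1 + M2 + m + 1)).coeff
          ((m + 1) * k r + r.succ))).det =
      (∏ s : Fin m, ∏ r ∈ univ.filter (fun r : Fin m => r < s),
        ((1 - q ^ (((m + 1 : ℕ) : ℤ) * k r - ((m + 1 : ℕ) : ℤ) * k s + ((r : ℕ) : ℤ) -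
            ((s : ℕ) : ℤ))) / (1 - q ^ (((r : ℕ) : ℤ) - ((s : ℕ) : ℤ))))) *
        (∏ r : Fin m,
          qPoch q (q ^ (-(M1 : ℤ) - M2 - (m + 1 : ℕ) + ((r : ℕ) + 1))) ((m + 1) * k r) /
              qPoch q (q ^ ((r : ℕ) + 1)) ((m + 1) * k r) *
            q ^ (M2 * ((m + 1) * k r))) *
        q ^ ((m + 1) * ∑ r : Fin m, ((r : ℕ) + 1) * k r) *
      (Matrix.of (Fin.cons (fun _ => 1) fun (r : Fin m) (s : Fin (m + 1)) =>
        (shiftedEulerPoly q ((s : ℕ) + -((M1 : ℤ) + m)) (M1 + M2 + m + 1)).coeff r.succ)).det := by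
  rw [det_shiftedEulerPoly_coeff hq0, det_shiftedEulerPoly_coeff hq0, mul_sum,
    ← prod_pow_eq_pow_sum]
  simp only [Fin.val_succ]
  have hpair : (∏ s : Fin m, ∏ r ∈ univ.filter (fun r : Fin m => r < s),
      (1 - q ^ ((((m + 1) * k r + ((r : ℕ) + 1) : ℕ) : ℤ) -
        ((m + 1) * k s + ((s : ℕ) + 1) : ℕ)))) =
      (∏ s : Fin m, ∏ r ∈ univ.filter (fun r : Fin m => r < s),
        ((1 - q ^ (((m + 1 : ℕ) : ℤ) * k r - ((m + 1 : ℕ) : ℤ) * k s + ((r : ℕ) : ℤ) -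
            ((s : ℕ) : ℤ))) / (1 - q ^ (((r : ℕ) : ℤ) - ((s : ℕ) : ℤ))))) *
      ∏ s : Fin m, ∏ r ∈ univ.filter (fun r : Fin m => r < s),
        (1 - q ^ ((((r : ℕ) + 1 : ℕ) : ℤ) - ((s : ℕ) + 1 : ℕ))) := by
    simp only [← prod_mul_distrib]
    refine prod_congr rfl fun s _ => prod_congr rfl fun r hr => ?_
    have hrs : (r : ℕ) < s := (mem_filter.mp hr).2
    have h : (((r : ℕ) + 1 : ℕ) : ℤ) - ((s : ℕ) + 1 : ℕ) = (r : ℕ) - (s : ℕ) := by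
      push_cast
      ring
    rw [h, div_mul_cancel₀ _ (one_sub_zpow_ne_zero hq (by omega))]
    congr 2
    push_cast
    ring
  have hrow : (∏ r : Fin m, (-q ^ (-((M1 : ℤ) + m))) ^ ((m + 1) * k r + ((r : ℕ) + 1)) *
      (eulerPoly q (M1 + M2 + m + 1)).coeff ((m + 1) * k r + ((r : ℕ) + 1)) *
        (q ^ (((m + 1) * k r + ((r : ℕ) + 1)) * ((r : ℕ) + 1)) *
          (1 - q ^ (-(((m + 1) * k r + ((r : ℕ) + 1) : ℕ) : ℤ))))) =
      (∏ r : Fin m,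
          qPoch q (q ^ (-(M1 : ℤ) - M2 - (m + 1 : ℕ) + ((r : ℕ) + 1))) ((m + 1) * k r) /
              qPoch q (q ^ ((r : ℕ) + 1)) ((m + 1) * k r) *
            q ^ (M2 * ((m + 1) * k r))) *
        (∏ r : Fin m, q ^ ((m + 1) * (((r : ℕ) + 1) * k r))) *
      ∏ r : Fin m, (-q ^ (-((M1 : ℤ) + m))) ^ ((r : ℕ) + 1) *
      (eulerPoly q (M1 + M2 + m + 1)).coeff ((r : ℕ) + 1) *
        (q ^ (((r : ℕ) + 1) * ((r : ℕ) + 1)) *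
          (1 - q ^ (-(((r : ℕ) + 1 : ℕ) : ℤ)))) := by
    simp only [← prod_mul_distrib]
    refine prod_congr rfl fun r _ => ?_
    have h := eulerPoly_coeff_ratio hq0 M1 M2 m (r + 1) ((m + 1) * k r)
    have hne := qPoch_pow_ne_zero hq (Nat.succ_pos (r : ℕ)) ((m + 1) * k r)
    rw [Nat.succ_eq_add_one] at hne
    rw [Nat.cast_add_one (r : ℕ)] at h
    rw [div_mul_eq_mul_div, div_mul_eq_mul_div, div_mul_eq_mul_div, eq_div_iff hne, pow_add,
      add_mul _ _ ((r : ℕ) + 1), pow_add q, show (m + 1) * k r * ((r : ℕ) + 1) =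
        (m + 1) * (((r : ℕ) + 1) * k r) by ring, Nat.cast_add_one (r : ℕ)]
    linear_combination (-q ^ (-((M1 : ℤ) + m))) ^ ((r : ℕ) + 1) *
      q ^ ((m + 1) * (((r : ℕ) + 1) * k r)) * q ^ (((r : ℕ) + 1) * ((r : ℕ) + 1)) * h
  rw [hpair, hrow]
  ring

lemma qPoch_zpow_neg_ne_zero (hq : ∀ m : ℕ, 0 < m → q ^ m ≠ 1) (hq0 : q ≠ 0) (M : ℕ) :
    qPoch q (q ^ (-(M : ℤ))) M ≠ 0 := by
  intro h
  have := qPoch_zpow_neg hq0 M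
  rw [h, mul_zero] at this
  exact mul_ne_zero (pow_ne_zero M (neg_ne_zero.mpr one_ne_zero)) (qPoch_self_ne_zero hq M)
    this.symm

lemma eulerPoly_coeff_ne_zero (hq0 : q ≠ 0) (hq : ∀ m : ℕ, 0 < m → q ^ m ≠ 1) {N y : ℕ}
    (h : y ≤ N) : (eulerPoly q N).coeff y ≠ 0 := by
  obtain ⟨b, rfl⟩ := Nat.exists_eq_add_of_le h
  rw [eulerPoly_coeff_add hq]
  exact div_ne_zero (mul_ne_zero (pow_ne_zero _ hq0) (qPoch_self_ne_zero hq _))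
    (mul_ne_zero (qPoch_self_ne_zero hq _) (qPoch_self_ne_zero hq _))

lemma det_shiftedEulerPoly_coeff_ne_zero (hq0 : q ≠ 0) (hq : ∀ m : ℕ, 0 < m → q ^ m ≠ 1)
    {m N : ℕ} (hN : m ≤ N) (d : ℤ) :
    (Matrix.of (Fin.cons (fun _ => 1) fun (r : Fin m) (s : Fin (m + 1)) =>
        (shiftedEulerPoly q ((s : ℕ) + d) N).coeff r.succ)).det ≠ 0 := by
  rw [det_shiftedEulerPoly_coeff hq0]
  refine mul_ne_zero (prod_ne_zero_iff.mpr fun r _ => ?_)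
    (prod_ne_zero_iff.mpr fun s _ => prod_ne_zero_iff.mpr fun r hr => ?_)
  · have hr := r.isLt
    refine mul_ne_zero (mul_ne_zero (pow_ne_zero _ (neg_ne_zero.mpr (zpow_ne_zero _ hq0)))
      (eulerPoly_coeff_ne_zero hq0 hq ?_)) (mul_ne_zero (pow_ne_zero _ hq0)
      (one_sub_zpow_ne_zero hq ?_))
    · rw [Fin.val_succ]
      omega
    · rw [Fin.val_succ]
      omega
  · have hrs : (r : ℕ) < s := (mem_filter.mp hr).2
    refine one_sub_zpow_ne_zero hq ?_
    simp only [Fin.val_succ]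
    omega

lemma finsum_eq_adjugate (hq0 : q ≠ 0) (hq : ∀ m : ℕ, 0 < m → q ^ m ≠ 1) (m M1 M2 : ℕ) :
    (∑ᶠ k : Fin m → ℕ,
      if ∀ r : Fin m, (m + 1) * k r + ((r : ℕ) + 1) ≤ M1 + M2 + (m + 1) then
        (∏ s : Fin m, ∏ r ∈ univ.filter (fun r : Fin m => r < s),
          ((1 - q ^ (((m + 1 : ℕ) : ℤ) * k r - ((m + 1 : ℕ) : ℤ) * k s + ((r : ℕ) : ℤ) -
              ((s : ℕ) : ℤ))) / (1 - q ^ (((r : ℕ) : ℤ) - ((s : ℕ) : ℤ))))) *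
          (∏ r : Fin m,
            qPoch q (q ^ (-(M1 : ℤ) - M2 - (m + 1 : ℕ) + ((r : ℕ) + 1))) ((m + 1) * k r) /
                qPoch q (q ^ ((r : ℕ) + 1)) ((m + 1) * k r) *
              q ^ (M2 * ((m + 1) * k r))) *
          q ^ ((m + 1) * ∑ r : Fin m, ((r : ℕ) + 1) * k r)
      else 0) =
      (aeval (cyclicShift F m) (shiftedEulerPoly q (-M1) (M1 + M2 + 1))).adjugate 0 0 := by
  set d : ℤ := -((M1 : ℤ) + m) with hd
  have hf (s : Fin (m + 1)) : shiftedEulerPoly q ((s : ℕ) + d) (M1 + M2 + m + 1) =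
      shiftedEulerPoly q (-M1) (M1 + M2 + 1) *
        (shiftedEulerPoly q ((s : ℕ) + d) (m - s) * shiftedEulerPoly q (M2 + 1) s) := by
    have hs := Nat.lt_succ_iff.mp s.isLt
    rw [show M1 + M2 + m + 1 = (m - s) + ((M1 + M2 + 1) + s) by omega, shiftedEulerPoly_add,
      shiftedEulerPoly_add, show ((s : ℕ) : ℤ) + d + (m - s : ℕ) = -M1 by omega,
      show -(M1 : ℤ) + (M1 + M2 + 1 : ℕ) = M2 + 1 by push_cast; ring]
    ring
  have hne := det_shiftedEulerPoly_coeff_ne_zero hq0 hq (show m ≤ M1 + M2 + m + 1 by omega) d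
  have key := sum_det_cons_coeff (m := m) (K := M1 + M2 + m + 2)
    (shiftedEulerPoly_coeff_zero (q := q) (-M1) (M1 + M2 + 1))
    (f := fun s => shiftedEulerPoly q ((s : ℕ) + d) (m - s) * shiftedEulerPoly q (M2 + 1) s)
    (fun s => by
      have hs := Nat.lt_succ_iff.mp s.isLt
      have h := natDegree_mul_le_of_le
        (shiftedEulerPoly_natDegree_le (q := q) ((s : ℕ) + d) (m - s))
        (shiftedEulerPoly_natDegree_le (q := q) (M2 + 1) s)
      omega)
    (fun s => by
      rw [mul_coeff_zero, shiftedEulerPoly_coeff_zero, shiftedEulerPoly_coeff_zero, mul_one])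
    (fun s => by
      rw [← hf s]
      refine (shiftedEulerPoly_natDegree_le _ _).trans_lt ?_
      nlinarith)
  simp only [← hf] at key
  have hdet : (Matrix.of fun t s : Fin (m + 1) =>
      (shiftedEulerPoly q ((s : ℕ) + d) (M1 + M2 + m + 1)).coeff t) =
      Matrix.of (Fin.cons (fun _ => 1) fun (r : Fin m) (s : Fin (m + 1)) =>
        (shiftedEulerPoly q ((s : ℕ) + d) (M1 + M2 + m + 1)).coeff r.succ) := by
    ext i j
    refine Fin.cases ?_ (fun r => ?_) i
    · simp [shiftedEulerPoly_coeff_zero]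
    · simp
  rw [hdet] at key
  refine mul_right_cancel₀ hne (Eq.trans ?_ key)
  rw [finsum_eq_sum_of_support_subset (s := Fintype.piFinset fun _ => range (M1 + M2 + m + 2)),
    sum_mul]
  · refine sum_congr rfl fun k _ => ?_
    split_ifs with h
    · rw [det_shiftedEulerPoly_coeff_eq_mul hq0 hq]
    · push Not at h
      obtain ⟨r, hr⟩ := h
      rw [zero_mul, det_shiftedEulerPoly_coeff hq0, prod_eq_zero (mem_univ r), zero_mul]
      rw [coeff_eq_zero_of_natDegree_lt, mul_zero, zero_mul]
      refine (eulerPoly_natDegree_le q _).trans_lt ?_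
      rw [Fin.val_succ]
      omega
  · intro k hk
    rw [Function.mem_support, ne_eq, ite_eq_right_iff, Classical.not_imp] at hk
    rw [mem_coe, Fintype.mem_piFinset]
    intro r
    have := hk.1 r
    rw [mem_range]
    nlinarith

end EntangledSum

/-- The transformation formula obtained from Milne's `A_n` Watson transformation:
the `S = 0` sum of Warnaar's identity equals an "entangled" `(n-1)`-fold sum,
for `M_1, M_2` both divisible by `n`. -/
theorem warnaar_entangled_transformation {F : Type*} [Field F] (q : F) (hq0 : q ≠ 0)
    (hq : ∀ m : ℕ, 0 < m → q ^ m ≠ 1)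
    (n : ℕ) (hn : 0 < n) (M1 M2 : ℕ) (hM1 : n ∣ M1) (hM2 : n ∣ M2) :
    (∑ᶠ k : Fin n → ℤ,
      if (∑ i, k i) = 0 ∧
          ∀ i : Fin n, 0 ≤ (M1 : ℤ) + n * k i + (i : ℕ) ∧
            0 ≤ (M2 : ℤ) - n * k i + n - ((i : ℕ) + 1) then
        q ^ ((((n + 1).choose 2 : ℕ) : ℤ) * (∑ i, (k i) ^ 2) +
              ∑ i : Fin n, (((i : ℕ) : ℤ) + 1) * k i) *
          (∏ j : Fin n, ∏ i ∈ Finset.univ.filter (fun i : Fin n => i < j),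
            (1 - q ^ ((n : ℤ) * k j - (n : ℤ) * k i + ((j : ℕ) : ℤ) - ((i : ℕ) : ℤ)))) *
          ∏ i : Fin n,
            qPoch q q (M1 + M2 + (i : ℕ)) /
              (qPoch q q ((M1 : ℤ) + n * k i + (i : ℕ)).toNat *
                qPoch q q ((M2 : ℤ) - n * k i + n - ((i : ℕ) + 1)).toNat)
      else 0) =
    (-1 : F) ^ M1 * q ^ (-(((M1 + 1).choose 2 : ℕ) : ℤ)) * qPoch q q (M1 + M2) /
        (qPoch (q ^ n) (q ^ (-(n : ℤ) * M1)) M1 * qPoch (q ^ n) (q ^ n) M2) *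
      (∑ᶠ k : Fin (n - 1) → ℕ,
        if ∀ r : Fin (n - 1), n * k r + ((r : ℕ) + 1) ≤ M1 + M2 + n then
          (∏ s : Fin (n - 1), ∏ r ∈ Finset.univ.filter (fun r : Fin (n - 1) => r < s),
            ((1 - q ^ ((n : ℤ) * k r - (n : ℤ) * k s + ((r : ℕ) : ℤ) - ((s : ℕ) : ℤ))) /
              (1 - q ^ (((r : ℕ) : ℤ) - ((s : ℕ) : ℤ))))) *
            (∏ r : Fin (n - 1),
              qPoch q (q ^ (-(M1 : ℤ) - M2 - n + ((r : ℕ) + 1))) (n * k r) /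
                  qPoch q (q ^ ((r : ℕ) + 1)) (n * k r) *
                q ^ (M2 * (n * k r))) *
            q ^ (n * ∑ r : Fin (n - 1), ((r : ℕ) + 1) * k r)
        else 0) := by
  obtain ⟨m, rfl⟩ := Nat.exists_eq_add_of_le' hn
  obtain ⟨m1, hm1⟩ := hM1
  have hleft := finsum_eq_thetaEulerSum hq0 hq m m1 M2
  have htheta := thetaEulerSum_add (m := m) hq0 hq M2 M1
  have hsign : (-1 : F) ^ (m * M1) = 1 := by
    rw [hm1, ← mul_assoc, pow_mul, (Nat.even_mul_succ_self m).neg_one_pow, one_pow]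
  rw [← hm1, add_comm M1 M2, htheta, hsign, one_mul, add_comm M2 M1] at hleft
  have hright := finsum_eq_adjugate hq0 hq m M1 M2
  have h1 := qPoch_zpow_neg_ne_zero hq hq0 M1
  have h2 := qPoch_self_ne_zero hq M2
  rw [adjugate_aeval_shiftedEulerPoly hq0 m M1 M2 h1 h2] at hright
  have hQ : ∀ j : ℕ, 0 < j → (q ^ (m + 1)) ^ j ≠ 1 := fun j hj => by
    rw [← pow_mul]
    exact hq _ (by positivity)
  have h4 := qPoch_zpow_neg_ne_zero hQ (pow_ne_zero _ hq0) M1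
  rw [← zpow_natCast q (m + 1), ← zpow_mul, zpow_natCast q (m + 1), mul_neg, ← neg_mul] at h4
  have h5 := qPoch_self_ne_zero hQ M2
  have h6 := qPoch_zpow_neg hq0 M1
  have h3 := qPoch_self_ne_zero hq M1
  refine (mul_left_cancel₀ (pow_ne_zero _ hq0) hleft).trans
    (Eq.trans ?_ (congrArg (fun x => _ * x) hright).symm)
  rw [zpow_neg, zpow_natCast]
  rw [div_mul_div_cancel₀ (mul_ne_zero h4 h5), div_eq_div_iff (mul_ne_zero h3 h2)
    (mul_ne_zero h1 h2)]
  field_simp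
  linear_combination qPoch q q (M1 + M2) * h6
end

section
/- (Determinant lemma.) Let R be a commutative ring, let n be a positive integer, and let X_1,…,X_n, A_2,…,A_n, B_2,…,B_n be elements of R. Then det_{1≤i,j≤n} ( (X_i+A_n)(X_i+A_{n-1})⋯(X_i+A_{j+1}) · (X_i+B_j)(X_i+B_{j-1})⋯(X_i+B_2) ) = ∏_{1≤i<j≤n} (X_i - X_j) · ∏_{2≤i≤j≤n} (B_i - A_j), where the (i,j) entry of the matrix is the product of the factors (X_i + A_t) for t = j+1,…,n and the factors (X_i + B_t) for t = 2,…,j (empty products being equal to 1). -/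
section

variable {R : Type*} [CommRing R]

open Polynomial

/-- The polynomial `(x + a_j)⋯(x + a_{m-1}) · (x + b_0)⋯(x + b_{j-1})`. -/
noncomputable def mixedProd (a b : ℕ → R) (m j : ℕ) : R[X] :=
  (∏ t ∈ Finset.Ico j m, (X + C (a t))) * ∏ t ∈ Finset.range j, (X + C (b t))

theorem monic_mixedProd (a b : ℕ → R) (m j : ℕ) : (mixedProd a b m j).Monic :=
  (monic_prod_of_monic _ _ fun t _ => monic_X_add_C (a t)).mul
    (monic_prod_of_monic _ _ fun t _ => monic_X_add_C (b t))

theorem natDegree_mixedProd [Nontrivial R] (a b : ℕ → R) {m j : ℕ} (h : j ≤ m) :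
    (mixedProd a b m j).natDegree = m := by
  rw [mixedProd, (monic_prod_of_monic _ _ fun t _ => monic_X_add_C (a t)).natDegree_mul
    (monic_prod_of_monic _ _ fun t _ => monic_X_add_C (b t)),
    natDegree_prod_of_monic _ _ fun t _ => monic_X_add_C (a t),
    natDegree_prod_of_monic _ _ fun t _ => monic_X_add_C (b t)]
  simp [h]

theorem mixedProd_succ_succ (a b : ℕ → R) {m j : ℕ} (h : j ≤ m) :
    mixedProd a b (m + 1) (j + 1) =
      C (b j - a j) * mixedProd (fun t => a (t + 1)) b m j + mixedProd a b (m + 1) j := by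
  have hs : ∏ t ∈ Finset.Ico j m, (X + C (a (t + 1))) =
      ∏ t ∈ Finset.Ico (j + 1) (m + 1), (X + C (a t)) :=
    Finset.prod_Ico_add' (fun t => X + C (a t)) j m 1
  rw [mixedProd, mixedProd, mixedProd, hs, Finset.prod_range_succ,
    Finset.prod_eq_prod_Ico_succ_bot (Nat.lt_succ_of_le h), C_sub]
  ring

theorem prod_triangle_succ (a b : ℕ → R) (m : ℕ) :
    ∏ j ∈ Finset.range (m + 1), ∏ i ∈ Finset.range (j + 1), (b i - a j) =
      (∏ j ∈ Finset.range (m + 1), (b j - a j)) *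
        ∏ j ∈ Finset.range m, ∏ i ∈ Finset.range (j + 1), (b i - a (j + 1)) := by
  simp_rw [Finset.prod_range_succ (fun i => b i - a _), Finset.prod_mul_distrib]
  rw [Finset.prod_range_succ' (fun j => ∏ i ∈ Finset.range j, (b i - a j)) m]
  simp_rw [Finset.prod_range_succ (fun i => b i - a _), Finset.prod_mul_distrib]
  simp [mul_comm]

theorem det_coeff_mixedProd [Nontrivial R] (b : ℕ → R) (m : ℕ) (a : ℕ → R) :
    Matrix.det (Matrix.of fun k j : Fin (m + 1) => (mixedProd a b m j).coeff (Fin.rev k)) =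
      ∏ j ∈ Finset.range m, ∏ i ∈ Finset.range (j + 1), (b i - a j) := by
  induction m generalizing a with
  | zero => simp [mixedProd]
  | succ m ih =>
    let N : Matrix (Fin (m + 2)) (Fin (m + 2)) R := Matrix.of fun k =>
      Fin.cons ((mixedProd a b (m + 1) 0).coeff (Fin.rev k)) fun j : Fin (m + 1) =>
        (b j - a j) * (mixedProd (fun t => a (t + 1)) b m j).coeff (Fin.rev k)
    have hN : Matrix.det (Matrix.of fun k j : Fin (m + 2) =>
        (mixedProd a b (m + 1) j).coeff (Fin.rev k)) = N.det := by
      refine Matrix.det_eq_of_forall_col_eq_smul_add_pred (fun _ => 1) ?_ ?_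
      · intro k
        simp [N]
      · intro k j
        simp [N, mixedProd_succ_succ a b (Nat.le_of_lt_succ j.2), -map_sub]
    have h00 : N 0 0 = 1 := by
      have h := (monic_mixedProd a b (m + 1) 0).coeff_natDegree
      rw [natDegree_mixedProd a b (Nat.zero_le _)] at h
      simpa [N] using h
    have h0 (j : Fin (m + 1)) : N 0 j.succ = 0 := by
      have h : (mixedProd (fun t => a (t + 1)) b m j).coeff (m + 1) = 0 :=
        coeff_eq_zero_of_natDegree_lt
          (by rw [natDegree_mixedProd _ b (Nat.le_of_lt_succ j.2)]; exact m.lt_succ_self)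
      simp [N, h]
    have hsub : N.submatrix Fin.succ Fin.succ = Matrix.of fun k j : Fin (m + 1) =>
        (b j - a j) * (Matrix.of fun k j : Fin (m + 1) =>
          (mixedProd (fun t => a (t + 1)) b m j).coeff (Fin.rev k)) k j := by
      ext k j
      simp [N]
    rw [hN, Matrix.det_succ_row_zero, Fin.sum_univ_succ]
    simp only [h00, h0, mul_zero, zero_mul, Finset.sum_const_zero, Fin.succAbove_zero]
    rw [hsub, Matrix.det_mul_row, ih, prod_triangle_succ,
      Fin.prod_univ_eq_prod_range (fun j => b j - a j)]
    simp

theorem det_eval_mixedProd [Nontrivial R] (m : ℕ) (x : Fin (m + 1) → R) (a b : ℕ → R) :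
    Matrix.det (Matrix.of fun i j : Fin (m + 1) => (mixedProd a b m j).eval (x i)) =
      (∏ i, ∏ j ∈ Finset.Ioi i, (x i - x j)) *
        ∏ j ∈ Finset.range m, ∏ i ∈ Finset.range (j + 1), (b i - a j) := by
  have hmul : (Matrix.of fun i j : Fin (m + 1) => (mixedProd a b m j).eval (x i)) =
      Matrix.projVandermonde 1 x *
        Matrix.of fun k j : Fin (m + 1) => (mixedProd a b m j).coeff (Fin.rev k) := by
    ext i j
    rw [Matrix.of_apply, eval_eq_sum_range,
      natDegree_mixedProd a b (Nat.le_of_lt_succ j.2), Matrix.mul_apply,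
      ← Fin.sum_univ_eq_sum_range (fun k => (mixedProd a b m j).coeff k * x i ^ k),
      ← Equiv.sum_comp Fin.revPerm]
    simp [Matrix.projVandermonde_apply, mul_comm]
  rw [hmul, Matrix.det_mul, det_coeff_mixedProd, Matrix.det_projVandermonde]
  simp

end

open Finset

/-- The determinant lemma [Krattenthaler, Lemma 2.2]: for indeterminates
`X_1,…,X_n`, `A_2,…,A_n`, `B_2,…,B_n`,
`det((X_i+A_n)⋯(X_i+A_{j+1})·(X_i+B_j)⋯(X_i+B_2)) = ∏_{i<j}(X_i-X_j)·∏_{2≤i≤j≤n}(B_i-A_j)`.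
Rows and columns are indexed by `Fin n`, with 1-based index `(·:ℕ)+1`. -/
theorem determinant_lemma {R : Type*} [CommRing R] (n : ℕ) (hn : 0 < n)
    (X : Fin n → R) (A B : ℕ → R) :
    Matrix.det (Matrix.of fun i j : Fin n =>
      (∏ t ∈ Finset.Icc ((j : ℕ) + 2) n, (X i + A t)) *
        (∏ t ∈ Finset.Icc 2 ((j : ℕ) + 1), (X i + B t))) =
    (∏ j : Fin n, ∏ i ∈ Finset.univ.filter (fun i : Fin n => i < j), (X i - X j)) *
      ∏ j ∈ Finset.Icc 2 n, ∏ i ∈ Finset.Icc 2 j, (B i - A j) := by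
  nontriviality R
  obtain ⟨m, rfl⟩ : ∃ m, n = m + 1 := ⟨n - 1, by omega⟩
  have hIcc (f : ℕ → R) (k l : ℕ) :
      ∏ t ∈ Finset.Icc (k + 2) (l + 1), f t = ∏ t ∈ Finset.Ico k l, f (t + 2) := by
    rw [Finset.prod_Ico_add' f k l 2]
    rfl
  have hdet := det_eval_mixedProd m X (fun t => A (t + 2)) (fun t => B (t + 2))
  simp only [mixedProd, Polynomial.eval_mul, Polynomial.eval_prod, Polynomial.eval_add,
    Polynomial.eval_X, Polynomial.eval_C] at hdet
  simp only [hIcc, ← Finset.range_eq_Ico]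
  rw [hdet]
  congr 1
  refine Finset.prod_comm' fun i j => ?_
  simp
end

section
/- Let n ≥ 2 be an integer and let ω be a primitive n-th root of unity in ℂ. Then ∏_{1≤i<j≤n-1} (ω^i - ω^j)(ω^{-i} - ω^{-j}) = n^{n-2}. -/
open Finset

namespace IsPrimitiveRoot

variable {K : Type*} [Field K] {n : ℕ} {ω : K}

lemma prod_Icc_one_sub_pow (hω : IsPrimitiveRoot ω n) (hn : 2 ≤ n) :
    ∏ k ∈ Icc 1 (n - 1), (1 - ω ^ k) = n := by
  obtain ⟨m, rfl⟩ : ∃ m, n = m + 1 := ⟨n - 1, by omega⟩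
  rw [Nat.cast_succ, ← hω.prod_one_sub_pow_eq_order, Nat.add_sub_cancel, range_eq_Ico,
    prod_Ico_add' (fun k ↦ 1 - ω ^ k) 0 m 1]
  rfl

lemma prod_Icc_one_sub_zpow_neg (hω : IsPrimitiveRoot ω n) (hn : 2 ≤ n) :
    ∏ k ∈ Icc 1 (n - 1), (1 - ω ^ (-(k : ℤ))) = n := by
  rw [← hω.inv.prod_Icc_one_sub_pow hn]
  simp

lemma prod_range_erase_one_sub_zpow (hω : IsPrimitiveRoot ω n) (hn : 2 ≤ n) {i : ℕ}
    (hi : i < n) : ∏ j ∈ (range n).erase i, (1 - ω ^ ((j : ℤ) - i)) = n := by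
  rw [← hω.prod_Icc_one_sub_pow hn]
  refine prod_nbij' (fun j ↦ if j < i then j + n - i else j - i)
    (fun k ↦ if k + i < n then k + i else k + i - n) ?_ ?_ ?_ ?_ ?_
  · simp only [mem_erase, mem_range, mem_Icc]; grind
  · simp only [mem_erase, mem_range, mem_Icc]; grind
  · simp only [mem_erase, mem_range]; grind
  · simp only [mem_Icc]; grind
  · intro j _
    have hω0 : ω ≠ 0 := hω.ne_zero (by omega)
    rw [← zpow_natCast]
    split_ifs with h
    · rw [show ((j + n - i : ℕ) : ℤ) = (j - i) + n by omega, zpow_add₀ hω0, zpow_natCast ω n,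
        hω.pow_eq_one, mul_one]
    · rw [Nat.cast_sub (not_lt.mp h)]

lemma one_sub_zpow_neg_mul_prod_erase (hω : IsPrimitiveRoot ω n) (hn : 2 ≤ n) {i : ℕ}
    (hi : i ∈ Icc 1 (n - 1)) :
    (1 - ω ^ (-(i : ℤ))) * ∏ j ∈ (Icc 1 (n - 1)).erase i, (1 - ω ^ ((j : ℤ) - i)) = n := by
  rw [mem_Icc] at hi
  have h : (range n).erase i = insert 0 ((Icc 1 (n - 1)).erase i) := by
    ext j
    simp only [mem_erase, mem_range, mem_insert, mem_Icc]
    omega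
  rw [← hω.prod_range_erase_one_sub_zpow hn (i := i) (by omega), h, prod_insert (by simp)]
  simp

end IsPrimitiveRoot

/-- A product over ordered pairs of distinct elements groups into a product over increasing
pairs. -/
lemma Finset.prod_filter_lt_mul_swap {ι M : Type*} [LinearOrder ι] [CommMonoid M]
    (s : Finset ι) (f : ι → ι → M) :
    ∏ p ∈ (s ×ˢ s).filter (fun p : ι × ι => p.1 < p.2), f p.1 p.2 * f p.2 p.1 =
      ∏ i ∈ s, ∏ j ∈ s.erase i, f i j := by
  have key (i : ι) : ∏ j ∈ s.erase i, f i j =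
      (∏ j ∈ s, if i < j then f i j else 1) * ∏ j ∈ s, if j < i then f i j else 1 := by
    rw [← prod_mul_distrib, ← filter_ne', prod_filter]
    refine prod_congr rfl fun j _ ↦ ?_
    rcases lt_trichotomy i j with h | rfl | h
    · simp [h, h.ne', h.not_gt]
    · simp
    · simp [h, h.ne, h.not_gt]
  simp_rw [key]
  rw [prod_mul_distrib, prod_mul_distrib, prod_filter, prod_filter, prod_product,
    prod_product_right]

/-- For a primitive `n`-th root of unity `ω` in `ℂ`,
`∏_{1≤i<j≤n-1} (ω^i - ω^j)(ω^{-i} - ω^{-j}) = n^{n-2}`. -/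
theorem prod_primitiveRoot_vandermonde_pairing (n : ℕ) (hn : 2 ≤ n)
    (ω : ℂ) (hω : IsPrimitiveRoot ω n) :
    (∏ p ∈ (Finset.Icc 1 (n - 1) ×ˢ Finset.Icc 1 (n - 1)).filter
        (fun p : ℕ × ℕ => p.1 < p.2),
      ((ω ^ p.1 - ω ^ p.2) * (ω ^ (-(p.1 : ℤ)) - ω ^ (-(p.2 : ℤ))))) =
    (n : ℂ) ^ (n - 2) := by
  have hω0 : ω ≠ 0 := hω.ne_zero (by omega)
  have hn0 : (n : ℂ) ≠ 0 := by exact_mod_cast (by omega : n ≠ 0)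
  have hpair (p : ℕ × ℕ) : (ω ^ p.1 - ω ^ p.2) * (ω ^ (-(p.1 : ℤ)) - ω ^ (-(p.2 : ℤ))) =
      (1 - ω ^ ((p.2 : ℤ) - p.1)) * (1 - ω ^ ((p.1 : ℤ) - p.2)) := by
    simp only [zpow_sub₀ hω0, zpow_neg, zpow_natCast]
    field_simp
  simp_rw [hpair]
  rw [prod_filter_lt_mul_swap _ fun i j : ℕ ↦ 1 - ω ^ ((j : ℤ) - i)]
  refine mul_left_cancel₀ hn0 ?_
  nth_rewrite 1 [← hω.prod_Icc_one_sub_zpow_neg hn]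
  rw [← prod_mul_distrib, prod_congr rfl fun i hi ↦ hω.one_sub_zpow_neg_mul_prod_erase hn hi,
    prod_const, Nat.card_Icc, ← pow_succ']
  congr 1
  omega
end
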